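/- arXiv:1608.02418 — 2 statements merged into one kernel-verified Lean document; each statement's English description precedes it below -/
import Mathlib

section
/- Let C be an algebra of global dimension at most 2, E = Ext^2_C(DC, C), and B = C ⋉ E the trivial extension. For a C-module M: id_C M ≤ 1 if and only if M ⊗_C B ≅ M as B-modules, and pd_C M ≤ 1 if and only if D(B ⊗_C DM) ≅ M as B-modules. -/
open CategoryTheory MulOpposite

open CategoryTheory MulOpposite

/-! Core definitions: right `A`-modules are modules over `Aᵐᵒᵖ`. -/

/-- The category of (small) modules over a ring `R`.  For a `k`-algebra `A`,
right `A`-modules are `Mdl Aᵐᵒᵖ`. -/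
abbrev Mdl (R : Type) [Ring R] := ModuleCat.{0} R

section Generic

variable (R : Type) [Ring R]

/-- `f : P → M` is a projective cover: `P` projective, `f` surjective with
superfluous kernel. -/
def IsProjCover {P M : Mdl R} (f : P →ₗ[R] M) : Prop :=
  Module.Projective R P ∧ Function.Surjective f ∧
    ∀ N : Submodule R P, N ⊔ LinearMap.ker f = ⊤ → N = ⊤

/-- `f : M → I` is an injective envelope: `I` injective, `f` injective with
essential image. -/
def IsInjEnv {M I : Mdl R} (f : M →ₗ[R] I) : Prop :=
  Module.Injective R I ∧ Function.Injective f ∧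
    ∀ K : Submodule R I, K ⊓ LinearMap.range f = ⊥ → K = ⊥

/-- `Hom_R(X, Y) = 0`. -/
def HomZero (X Y : Mdl R) : Prop := ∀ f : X →ₗ[R] Y, f = 0

/-- `X ∈ Gen M`: `X` is an epimorphic image of a finite direct sum of copies of `M`. -/
def MemGen (M X : Mdl R) : Prop :=
  ∃ (d : ℕ) (f : (Fin d → M) →ₗ[R] X), Function.Surjective f

/-- `X ∈ add M`: `X` is a direct summand of a finite direct sum of copies of `M`. -/
def MemAdd (M X : Mdl R) : Prop :=
  ∃ (n : ℕ) (s : X →ₗ[R] (Fin n → M)) (r : (Fin n → M) →ₗ[R] X),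
    r.comp s = LinearMap.id

/-- projective dimension at most 1: a length-one projective resolution exists. -/
def PdLE1 (M : Mdl R) : Prop :=
  ∃ (P1 P0 : Mdl R) (d1 : P1 →ₗ[R] P0) (d0 : P0 →ₗ[R] M),
    Module.Projective R P1 ∧ Module.Projective R P0 ∧
    Function.Injective d1 ∧ Function.Surjective d0 ∧
    LinearMap.range d1 = LinearMap.ker d0

/-- projective dimension at most 2. -/
def PdLE2 (M : Mdl R) : Prop :=
  ∃ (P2 P1 P0 : Mdl R) (d2 : P2 →ₗ[R] P1) (d1 : P1 →ₗ[R] P0) (d0 : P0 →ₗ[R] M),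
    Module.Projective R P2 ∧ Module.Projective R P1 ∧ Module.Projective R P0 ∧
    Function.Injective d2 ∧ Function.Surjective d0 ∧
    LinearMap.range d2 = LinearMap.ker d1 ∧ LinearMap.range d1 = LinearMap.ker d0

/-- injective dimension at most 1. -/
def IdLE1 (M : Mdl R) : Prop :=
  ∃ (I0 I1 : Mdl R) (d0 : M →ₗ[R] I0) (d1 : I0 →ₗ[R] I1),
    Module.Injective R I0 ∧ Module.Injective R I1 ∧
    Function.Injective d0 ∧ Function.Surjective d1 ∧
    LinearMap.range d0 = LinearMap.ker d1

/-- global dimension at most 2 (every module has projective dimension ≤ 2). -/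
def GlDimLE2 : Prop := ∀ M : Mdl R, PdLE2 R M

/-- global dimension exactly 2. -/
def GlDimEq2 : Prop := GlDimLE2 R ∧ ¬ ∀ M : Mdl R, PdLE1 R M

/-- `W` is a first syzygy `Ω M` of `M` (kernel of a projective cover). -/
def IsSyzygy (M W : Mdl R) : Prop :=
  ∃ (P : Mdl R) (f : P →ₗ[R] M), IsProjCover R f ∧
    Nonempty (W ≃ₗ[R] LinearMap.ker f)

/-- `W` is a first cosyzygy `Ω⁻¹ M` of `M` (cokernel of an injective envelope). -/
def IsCosyzygy (M W : Mdl R) : Prop :=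
  ∃ (I : Mdl R) (f : M →ₗ[R] I), IsInjEnv R f ∧
    Nonempty (W ≃ₗ[R] (I ⧸ LinearMap.range f))

/-- `P1 --d1--> P0 --d0--> M → 0` is a minimal projective presentation. -/
def IsMinPres {P1 P0 M : Mdl R} (d1 : P1 →ₗ[R] P0) (d0 : P0 →ₗ[R] M) : Prop :=
  IsProjCover R d0 ∧ Module.Projective R P1 ∧
  LinearMap.range d1 = LinearMap.ker d0 ∧
  ∀ N : Submodule R P1, N ⊔ LinearMap.ker d1 = ⊤ → N = ⊤

/-- `Ext¹_R(X, Y) = 0`, expressed as: every short exact sequence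
`0 → Y → Z → X → 0` splits. -/
def Ext1Zero (X Y : Mdl R) : Prop :=
  ∀ (Z : Mdl R) (i : Y →ₗ[R] Z) (p : Z →ₗ[R] X),
    Function.Injective i → Function.Surjective p →
    LinearMap.range i = LinearMap.ker p →
    ∃ s : X →ₗ[R] Z, p.comp s = LinearMap.id

/-- partial tilting module: `pd ≤ 1` and `Ext¹(M,M) = 0`. -/
def PartialTilting (M : Mdl R) : Prop := PdLE1 R M ∧ Ext1Zero R M M

/-- tilting module: partial tilting plus a coresolution
`0 → R → T' → T'' → 0` with `T', T'' ∈ add M` of the regular module. -/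
def IsTilting (M : Mdl R) : Prop :=
  PartialTilting R M ∧
  ∃ (T' T'' : Mdl R) (i : ModuleCat.of R R →ₗ[R] T') (p : T' →ₗ[R] T''),
    MemAdd R M T' ∧ MemAdd R M T'' ∧
    Function.Injective i ∧ Function.Surjective p ∧
    LinearMap.range i = LinearMap.ker p

/-- an indecomposable (nonzero) module. -/
def Indecomp (M : Mdl R) : Prop :=
  Nontrivial M ∧ ∀ (U V : Submodule R M), IsCompl U V → U = ⊥ ∨ V = ⊥

/-- the number of isomorphism classes of simple `R`-modules is `n`. -/
def SimpleCount (n : ℕ) : Prop :=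
  ∃ S : Fin n → Mdl R,
    (∀ i, IsSimpleModule R (S i)) ∧
    (∀ i j, Nonempty ((S i) ≃ₗ[R] (S j)) → i = j) ∧
    ∀ X : Mdl R, IsSimpleModule R X → ∃ i, Nonempty (X ≃ₗ[R] S i)

end Generic

section Duality

variable (k : Type) [Field k] (A : Type) [Ring A] [Algebra k A]

/-- `N` (a right `A`-module) is the `k`-linear dual `D M` of the left `A`-module `M`:
witnessed by a nondegenerate balanced `k`-bilinear pairing. -/
def IskDual (N : Mdl Aᵐᵒᵖ) (M : Mdl A) : Prop :=
  ∃ φ : N → M → k,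
    (∀ n n' m, φ (n + n') m = φ n m + φ n' m) ∧
    (∀ n m m', φ n (m + m') = φ n m + φ n m') ∧
    (∀ (c : k) n m, φ n ((algebraMap k A c) • m) = c * φ n m) ∧
    (∀ (a : A) n m, φ (op a • n) m = φ n (a • m)) ∧
    (∀ n, (∀ m, φ n m = 0) → n = 0) ∧
    (∀ m, (∀ n, φ n m = 0) → m = 0)

/-- `T = τ M`: the Auslander–Reiten translate of the right `A`-module `M`,
i.e. the `k`-dual of the transpose `Tr M` computed from a minimal projective
presentation. -/
def IsTau (M T : Mdl Aᵐᵒᵖ) : Prop :=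
  ∃ (P1 P0 : Mdl Aᵐᵒᵖ) (d1 : P1 →ₗ[Aᵐᵒᵖ] P0) (d0 : P0 →ₗ[Aᵐᵒᵖ] M),
    IsMinPres Aᵐᵒᵖ d1 d0 ∧
    ∃ (Tr : Mdl A) (q : (P1 →ₗ[Aᵐᵒᵖ] A) →ₗ[A] Tr),
      Function.Surjective q ∧
      (∀ g : P1 →ₗ[Aᵐᵒᵖ] A, q g = 0 ↔ ∃ f : P0 →ₗ[Aᵐᵒᵖ] A, g = f.comp d1) ∧
      IskDual k A T Tr

/-- `T = τ⁻¹ M`: the inverse Auslander–Reiten translate, `Tr (D M)`, computed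
from a minimal projective presentation of the left module `D M`. -/
def IsTauInv (M T : Mdl Aᵐᵒᵖ) : Prop :=
  ∃ (DM : Mdl A), IskDual k A M DM ∧
  ∃ (Q1 Q0 : Mdl A) (d1 : Q1 →ₗ[A] Q0) (d0 : Q0 →ₗ[A] DM),
    IsMinPres A d1 d0 ∧
    ∃ q : (Q1 →ₗ[A] A) →ₗ[Aᵐᵒᵖ] T,
      Function.Surjective q ∧
      ∀ g : Q1 →ₗ[A] A, q g = 0 ↔ ∃ f : Q0 →ₗ[A] A, g = f.comp d1

/-- `W = τ⁻¹ Ω⁻¹ M`. -/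
def IsTauInvCosyz (M W : Mdl Aᵐᵒᵖ) : Prop :=
  ∃ V, IsCosyzygy Aᵐᵒᵖ M V ∧ IsTauInv k A V W

/-- `W = τ Ω M`. -/
def IsTauSyz (M W : Mdl Aᵐᵒᵖ) : Prop :=
  ∃ V, IsSyzygy Aᵐᵒᵖ M V ∧ IsTau k A V W

/-- `M` is `τ`-rigid: `Hom(M, τM) = 0`. -/
def TauRigid (M : Mdl Aᵐᵒᵖ) : Prop :=
  ∀ T, IsTau k A M T → HomZero Aᵐᵒᵖ M T

/-- `M` is `τ`-tilting: `τ`-rigid with as many pairwise nonisomorphic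
indecomposable summands as there are simple modules. -/
def TauTilting (M : Mdl Aᵐᵒᵖ) : Prop :=
  TauRigid k A M ∧
  ∃ (n : ℕ) (N : Fin n → Mdl Aᵐᵒᵖ),
    (∀ i, Indecomp Aᵐᵒᵖ (N i)) ∧
    (∀ i j, Nonempty ((N i) ≃ₗ[Aᵐᵒᵖ] (N j)) → i = j) ∧
    Nonempty (M ≃ₗ[Aᵐᵒᵖ] ((i : Fin n) → N i)) ∧
    SimpleCount Aᵐᵒᵖ n

end Duality


section SplitExt

variable {B C : Type} [Ring B] [Ring C]

/-- a right `C`-module viewed as a right `B`-module via a ring hom `π : B → C`. -/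
def modAlong (π : B →+* C) (M : Mdl Cᵐᵒᵖ) : Mdl Bᵐᵒᵖ :=
  letI : Module Bᵐᵒᵖ M := Module.compHom M (RingHom.op π)
  ModuleCat.of _ M

/-- `X` is the induced module `M ⊗_C B` along `σ : C → B`, characterized by the
universal property of induction (extension of scalars). -/
def IsInducedAlong (σ : C →+* B) (M : Mdl Cᵐᵒᵖ) (X : Mdl Bᵐᵒᵖ) : Prop :=
  ∃ φ : M →+ X,
    (∀ (c : C) (m : M), φ (op c • m) = op (σ c) • φ m) ∧
    ∀ (Y : Mdl Bᵐᵒᵖ) (ψ : M →+ Y),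
      (∀ (c : C) (m : M), ψ (op c • m) = op (σ c) • ψ m) →
      ∃! h : X →ₗ[Bᵐᵒᵖ] Y, ∀ m, h (φ m) = ψ m

/-- `X` is the coinduced module `D(B ⊗_C D M) ≅ Hom_C(B, M)` along `σ : C → B`,
characterized by the universal property of coinduction. -/
def IsCoinducedAlong (σ : C →+* B) (M : Mdl Cᵐᵒᵖ) (X : Mdl Bᵐᵒᵖ) : Prop :=
  ∃ p : X →+ M,
    (∀ (c : C) (x : X), p (op (σ c) • x) = op c • p x) ∧
    ∀ (Y : Mdl Bᵐᵒᵖ) (ψ : Y →+ M),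
      (∀ (c : C) (y : Y), ψ (op (σ c) • y) = op c • ψ y) →
      ∃! h : Y →ₗ[Bᵐᵒᵖ] X, ∀ y, p (h y) = ψ y

end SplitExt

section TrivExt

variable (C : Type) [Ring C] (E : Type) [AddCommGroup E]
  [Module C E] [Module Cᵐᵒᵖ E] [SMulCommClass C Cᵐᵒᵖ E]

/-- the projection `B = C ⋉ E → C` as a ring hom. -/
def tszeFst : TrivSqZeroExt C E →+* C where
  toFun := TrivSqZeroExt.fst
  map_one' := rfl
  map_mul' _ _ := rfl
  map_zero' := rfl
  map_add' _ _ := rfl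

/-- the inclusion `σ : C → B = C ⋉ E` as a ring hom. -/
def tszeInl : C →+* TrivSqZeroExt C E where
  toFun := TrivSqZeroExt.inl
  map_one' := rfl
  map_mul' x y := TrivSqZeroExt.inl_mul (M := E) x y
  map_zero' := TrivSqZeroExt.inl_zero (M := E)
  map_add' x y := TrivSqZeroExt.inl_add (M := E) x y

/-- a right `C`-module viewed as a module over the trivial extension `C ⋉ E`. -/
def modB (M : Mdl Cᵐᵒᵖ) : Mdl (TrivSqZeroExt C E)ᵐᵒᵖ :=
  modAlong (tszeFst C E) M

/-- `X = M ⊗_C B` for `B = C ⋉ E`. -/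
def IsInduced (M : Mdl Cᵐᵒᵖ) (X : Mdl (TrivSqZeroExt C E)ᵐᵒᵖ) : Prop :=
  IsInducedAlong (tszeInl C E) M X

/-- `X = D(B ⊗_C D M)` for `B = C ⋉ E`. -/
def IsCoinduced (M : Mdl Cᵐᵒᵖ) (X : Mdl (TrivSqZeroExt C E)ᵐᵒᵖ) : Prop :=
  IsCoinducedAlong (tszeInl C E) M X

end TrivExt

section RelExt

variable (k : Type) [Field k] (C : Type) [Ring C] [Algebra k C]
  (E : Type) [AddCommGroup E] [Module C E] [Module Cᵐᵒᵖ E]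

/-- The `C`-`C`-bimodule `E` is `Ext²_C(DC, C)`: there is a projective
resolution `0 → P2 → P1 → P0 → DC → 0` of the right module `DC = Hom_k(C,k)`
(characterized by a nondegenerate balanced pairing `φ` with `C`), and `E` is
the cokernel of `Hom_C(P1, C) → Hom_C(P2, C)` as a left `C`-module, with the
right `C`-action on `E` induced (contravariantly, via lifts of the left action
on `DC`) by functoriality of `Ext²(-, C)`. -/
def IsRelExt : Prop :=
  ∃ (DC : Mdl Cᵐᵒᵖ) (φ : DC → C → k),
    (∀ n n' m, φ (n + n') m = φ n m + φ n' m) ∧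
    (∀ n m m', φ n (m + m') = φ n m + φ n m') ∧
    (∀ (c : k) n m, φ n ((algebraMap k C c) * m) = c * φ n m) ∧
    (∀ (a : C) n m, φ (op a • n) m = φ n (a * m)) ∧
    (∀ n, (∀ m, φ n m = 0) → n = 0) ∧
    (∀ m, (∀ n, φ n m = 0) → m = 0) ∧
    ∃ (P2 P1 P0 : Mdl Cᵐᵒᵖ) (d2 : P2 →ₗ[Cᵐᵒᵖ] P1) (d1 : P1 →ₗ[Cᵐᵒᵖ] P0)
      (d0 : P0 →ₗ[Cᵐᵒᵖ] DC),
      Module.Projective Cᵐᵒᵖ P2 ∧ Module.Projective Cᵐᵒᵖ P1 ∧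
      Module.Projective Cᵐᵒᵖ P0 ∧
      Function.Injective d2 ∧ Function.Surjective d0 ∧
      LinearMap.range d2 = LinearMap.ker d1 ∧
      LinearMap.range d1 = LinearMap.ker d0 ∧
      ∃ q : (P2 →ₗ[Cᵐᵒᵖ] C) →ₗ[C] E,
        Function.Surjective q ∧
        (∀ g : P2 →ₗ[Cᵐᵒᵖ] C, q g = 0 ↔ ∃ f : P1 →ₗ[Cᵐᵒᵖ] C, g = f.comp d2) ∧
        ∀ c : C, ∃ (μ : DC →ₗ[Cᵐᵒᵖ] DC) (f0 : P0 →ₗ[Cᵐᵒᵖ] P0)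
            (f1 : P1 →ₗ[Cᵐᵒᵖ] P1) (f2 : P2 →ₗ[Cᵐᵒᵖ] P2),
          (∀ n x, φ (μ n) x = φ n (x * c)) ∧
          d0.comp f0 = μ.comp d0 ∧
          d1.comp f1 = f0.comp d1 ∧
          d2.comp f2 = f1.comp d2 ∧
          ∀ g : P2 →ₗ[Cᵐᵒᵖ] C, q (g.comp f2) = op c • q g

end RelExt



section HomAlg
open CategoryTheory Abelian

variable {R : Type} [Ring R]

/-- the morphism attached to a linear map -/
def ieh {X Y : ModuleCat.{0} R} (f : X →ₗ[R] Y) : X ⟶ Y := ModuleCat.ofHom f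

lemma ieh_comp {X Y Z : ModuleCat.{0} R} (f : X →ₗ[R] Y) (g : Y →ₗ[R] Z) :
    ieh f ≫ ieh g = ieh (g.comp f) := rfl

lemma ieh_add {X Y : ModuleCat.{0} R} (f g : X →ₗ[R] Y) : ieh (f + g) = ieh f + ieh g := rfl

lemma ieh_zero {X Y : ModuleCat.{0} R} : ieh (0 : X →ₗ[R] Y) = 0 := rfl

lemma ieh_id {X : ModuleCat.{0} R} : ieh (LinearMap.id : X →ₗ[R] X) = 𝟙 X := rfl

lemma ieh_inj {X Y : ModuleCat.{0} R} {f g : X →ₗ[R] Y} (h : ieh f = ieh g) : f = g :=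
  congrArg ModuleCat.Hom.hom h

lemma ieh_surj {X Y : ModuleCat.{0} R} (f : X ⟶ Y) : ∃ g : X →ₗ[R] Y, ieh g = f := ⟨f.hom, rfl⟩

lemma ieh_sum {X Y : ModuleCat.{0} R} {ι : Type} [Fintype ι] (f : ι → (X →ₗ[R] Y)) :
    ieh (∑ i, f i) = ∑ i, ieh (f i) :=
  map_sum (AddMonoidHom.mk' (fun f : X →ₗ[R] Y => ieh f) (fun _ _ => rfl)) f Finset.univ

/-- short exact sequence of linear maps -/
structure IeSes {X Y Z : ModuleCat.{0} R} (f : X →ₗ[R] Y) (g : Y →ₗ[R] Z) : Prop where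
  inj : Function.Injective f
  surj : Function.Surjective g
  ex : LinearMap.range f = LinearMap.ker g

namespace IeSes
variable {X Y Z : ModuleCat.{0} R} {f : X →ₗ[R] Y} {g : Y →ₗ[R] Z} (h : IeSes f g)

/-- the short complex attached to two composable linear maps -/
def S : ShortComplex (ModuleCat.{0} R) :=
  ShortComplex.mk (X₁ := X) (X₂ := Y) (X₃ := Z) (ieh f) (ieh g) (by
    rw [ieh_comp, ← ieh_zero]
    congr 1
    ext x
    have : f x ∈ LinearMap.ker g := h.ex ▸ LinearMap.mem_range_self f x
    simpa using this)

lemma se : (h.S).ShortExact :=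
  ModuleCat.shortComplex_shortExact _ (LinearMap.exact_iff.mpr h.ex.symm) h.inj h.surj

/-- the class of the extension -/
noncomputable def cls : Ext Z X 1 := h.se.extClass

lemma cls_comp : h.cls.comp (Ext.mk₀ (ieh f)) (add_zero 1) = 0 := h.se.extClass_comp

lemma contra1 {W : ModuleCat.{0} R} {n₀ : ℕ} (x₁ : Ext X W n₀) {n₁ : ℕ} (hn₁ : 1 + n₀ = n₁)
    (hx₁ : h.cls.comp x₁ hn₁ = 0) :
    ∃ (x₂ : Ext Y W n₀), (Ext.mk₀ (ieh f)).comp x₂ (zero_add n₀) = x₁ :=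
  Ext.contravariant_sequence_exact₁ h.se W x₁ hn₁ hx₁

lemma contra2 (h : IeSes f g) {W : ModuleCat.{0} R} {n : ℕ} (x₂ : Ext Y W n)
    (hx₂ : (Ext.mk₀ (ieh f)).comp x₂ (zero_add n) = 0) :
    ∃ (x₁ : Ext Z W n), (Ext.mk₀ (ieh g)).comp x₁ (zero_add n) = x₂ :=
  Ext.contravariant_sequence_exact₂ h.se W x₂ hx₂

lemma contra3 {W : ModuleCat.{0} R} {n₁ : ℕ} (x₃ : Ext Z W n₁)
    (hx₃ : (Ext.mk₀ (ieh g)).comp x₃ (zero_add n₁) = 0) {n₀ : ℕ} (hn₁ : 1 + n₀ = n₁) :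
    ∃ (x₁ : Ext X W n₀), h.cls.comp x₁ hn₁ = x₃ :=
  Ext.contravariant_sequence_exact₃ h.se W x₃ hx₃ hn₁

lemma cov1 {W : ModuleCat.{0} R} {n₁ : ℕ} (x₁ : Ext W X n₁)
    (hx₁ : x₁.comp (Ext.mk₀ (ieh f)) (add_zero n₁) = 0) {n₀ : ℕ} (hn₀ : n₀ + 1 = n₁) :
    ∃ (x₃ : Ext W Z n₀), x₃.comp h.cls hn₀ = x₁ :=
  Ext.covariant_sequence_exact₁ W h.se x₁ hx₁ hn₀

lemma cov3 {W : ModuleCat.{0} R} {n₀ : ℕ} (x₃ : Ext W Z n₀) {n₁ : ℕ} (hn₁ : n₀ + 1 = n₁)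
    (hx₃ : x₃.comp h.cls hn₁ = 0) :
    ∃ (x₂ : Ext W Y n₀), x₂.comp (Ext.mk₀ (ieh g)) (add_zero n₀) = x₃ :=
  Ext.covariant_sequence_exact₃ W h.se x₃ hn₁ hx₃

lemma nat {X' Y' Z' : ModuleCat.{0} R} {f' : X' →ₗ[R] Y'} {g' : Y' →ₗ[R] Z'} (h' : IeSes f' g')
    (a : X →ₗ[R] X') (b : Y →ₗ[R] Y') (c : Z →ₗ[R] Z') (hab : f'.comp a = b.comp f)
    (hbc : g'.comp b = c.comp g) :
    h.cls.comp (Ext.mk₀ (ieh a)) (add_zero 1) =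
      (Ext.mk₀ (ieh c)).comp h'.cls (zero_add 1) := by
  let φ : h.S ⟶ h'.S :=
    { τ₁ := ieh a
      τ₂ := ieh b
      τ₃ := ieh c
      comm₁₂ := congrArg ieh hab
      comm₂₃ := congrArg ieh hbc }
  exact ShortComplex.ShortExact.extClass_naturality h.se h'.se φ

lemma pd3 (h : IeSes f g) (n : ℕ) (h1 : HasProjectiveDimensionLT X n) (h2 : HasProjectiveDimensionLT Y (n + 1)) :
    HasProjectiveDimensionLT Z (n + 1) := h.se.hasProjectiveDimensionLT_X₃ n h1 h2

lemma pd1 (h : IeSes f g) (n : ℕ) (h1 : HasProjectiveDimensionLT Y n) (h2 : HasProjectiveDimensionLT Z (n + 1)) :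
    HasProjectiveDimensionLT X n := h.se.hasProjectiveDimensionLT_X₁ n h1 h2

lemma id1 (h : IeSes f g) (n : ℕ) (h1 : HasInjectiveDimensionLT Z n) (h2 : HasInjectiveDimensionLT Y (n + 1)) :
    HasInjectiveDimensionLT X (n + 1) := h.se.hasInjectiveDimensionLT_X₁ n h1 h2
end IeSes

lemma ie_proj {P : ModuleCat.{0} R} (h : Module.Projective R P) : Projective P :=
  (IsProjective.iff_projective P).mp h

lemma ie_pd1 {M : ModuleCat.{0} R} (h : PdLE1 R M) : HasProjectiveDimensionLT M 2 := by
  obtain ⟨P1, P0, d1, d0, h1, h0, hi, hs, he⟩ := h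
  have h1' := ie_proj h1
  have h0' := ie_proj h0
  exact IeSes.pd3 (f := d1) (g := d0) ⟨hi, hs, he⟩ 1 inferInstance inferInstance

lemma ie_id1 {M : ModuleCat.{0} R} (h : IdLE1 R M) : HasInjectiveDimensionLT M 2 := by
  obtain ⟨P1, P0, d1, d0, h1, h0, hi, hs, he⟩ := h
  have h1' : Injective P1 := (Module.injective_iff_injective_object R P1).mp h1
  have h0' : Injective P0 := (Module.injective_iff_injective_object R P0).mp h0
  exact IeSes.id1 (f := d1) (g := d0) ⟨hi, hs, he⟩ 1 inferInstance inferInstance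

/-- a length two projective resolution -/
structure IeRes (R : Type) [Ring R] (D : ModuleCat.{0} R) where
  P2 : ModuleCat.{0} R
  P1 : ModuleCat.{0} R
  P0 : ModuleCat.{0} R
  d2 : P2 →ₗ[R] P1
  d1 : P1 →ₗ[R] P0
  d0 : P0 →ₗ[R] D
  p2 : Module.Projective R P2
  p1 : Module.Projective R P1
  p0 : Module.Projective R P0
  inj : Function.Injective d2
  surj : Function.Surjective d0
  e1 : LinearMap.range d2 = LinearMap.ker d1
  e0 : LinearMap.range d1 = LinearMap.ker d0

namespace IeRes
variable {D : ModuleCat.{0} R} (P : IeRes R D)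

/-- the first syzygy -/
def K : ModuleCat.{0} R := ModuleCat.of R (LinearMap.ker P.d0)
/-- its inclusion -/
def i : P.K →ₗ[R] P.P0 := (LinearMap.ker P.d0).subtype
/-- the cover of the syzygy -/
def p : P.P1 →ₗ[R] P.K := P.d1.codRestrict (LinearMap.ker P.d0)
  (fun x => P.e0 ▸ LinearMap.mem_range_self P.d1 x)
lemma i_p (x : P.P1) : P.i (P.p x) = P.d1 x := rfl
lemma i_inj : Function.Injective P.i := Subtype.val_injective
lemma hi : LinearMap.range P.i = LinearMap.ker P.d0 := by
  unfold i; exact Submodule.range_subtype _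
lemma hp : LinearMap.range P.d2 = LinearMap.ker P.p := by
  rw [P.e1]; ext x
  rw [LinearMap.mem_ker, LinearMap.mem_ker, ← i_p]
  constructor
  · intro h; exact P.i_inj (by simpa using h)
  · intro h; rw [h]; simp
lemma p_surj : Function.Surjective P.p := by
  rintro ⟨x, hx⟩
  rw [← P.e0] at hx
  obtain ⟨y, rfl⟩ := hx
  exact ⟨y, rfl⟩
lemma s0 : IeSes P.i P.d0 := ⟨P.i_inj, P.surj, P.hi⟩
lemma s1 : IeSes P.d2 P.p := ⟨P.inj, P.p_surj, P.hp⟩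

lemma pd (P : IeRes R D) : HasProjectiveDimensionLT D 3 := by
  have h2' := ie_proj P.p2
  have h1' := ie_proj P.p1
  have h0' := ie_proj P.p0
  exact P.s0.pd3 2 (P.s1.pd3 1 inferInstance inferInstance)
    (inferInstanceAs (HasProjectiveDimensionLT P.P0 (2+1)))

/-- the class in `Ext²` of a map from `P2` -/
noncomputable def κ (Y : ModuleCat.{0} R) (g : P.P2 →ₗ[R] Y) : Ext D Y 2 :=
  P.s0.cls.comp (P.s1.cls.comp (Ext.mk₀ (ieh g)) (add_zero 1)) (by rfl : 1 + 1 = 2)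

lemma κ_add (Y : ModuleCat.{0} R) (g h : P.P2 →ₗ[R] Y) : P.κ Y (g + h) = P.κ Y g + P.κ Y h := by
  simp [κ, Ext.mk₀_add, ieh_add]

lemma κ_surj (Y : ModuleCat.{0} R) (y : Ext D Y 2) : ∃ g, P.κ Y g = y := by
  have h1' := ie_proj P.p1
  have h0' := ie_proj P.p0
  obtain ⟨z, hz⟩ := P.s0.contra3 y (Ext.eq_zero_of_projective _) (n₀ := 1) rfl
  obtain ⟨w, hw⟩ := P.s1.contra3 z (Ext.eq_zero_of_projective _) (n₀ := 0) rfl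
  obtain ⟨g, rfl⟩ := (Ext.mk₀_bijective _ _).2 w
  obtain ⟨g, rfl⟩ := ieh_surj g
  exact ⟨g, by rw [← hz, ← hw, κ]⟩

lemma κ_eq_zero (Y : ModuleCat.{0} R) (g : P.P2 →ₗ[R] Y) :
    P.κ Y g = 0 ↔ ∃ f : P.P1 →ₗ[R] Y, g = f.comp P.d2 := by
  have h1' := ie_proj P.p1
  have h0' := ie_proj P.p0
  constructor
  · intro h
    obtain ⟨z, hz⟩ := P.s0.contra1 _ (n₀ := 1) rfl h
    have hz0 : z = 0 := Ext.eq_zero_of_projective z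
    rw [hz0, Ext.comp_zero] at hz
    obtain ⟨w, hw⟩ := P.s1.contra1 _ (n₀ := 0) rfl hz.symm
    obtain ⟨f, rfl⟩ := (Ext.mk₀_bijective _ _).2 w
    obtain ⟨f, rfl⟩ := ieh_surj f
    rw [Ext.mk₀_comp_mk₀] at hw
    have := (Ext.mk₀_bijective _ _).1 hw
    rw [ieh_comp] at this
    exact ⟨f, (ieh_inj this).symm⟩
  · rintro ⟨f, rfl⟩
    have h0 : P.s1.cls.comp ((Ext.mk₀ (ieh P.d2)).comp (Ext.mk₀ (ieh f)) (zero_add 0))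
        (add_zero 1) = 0 := by
      rw [← Ext.comp_assoc_of_third_deg_zero, P.s1.cls_comp, Ext.zero_comp]
    rw [κ, ← ieh_comp, ← Ext.mk₀_comp_mk₀, h0, Ext.comp_zero]

lemma κ_nat (Y : ModuleCat.{0} R) (m : D →ₗ[R] D) (f0 : P.P0 →ₗ[R] P.P0)
    (f1 : P.P1 →ₗ[R] P.P1) (f2 : P.P2 →ₗ[R] P.P2) (h0 : P.d0.comp f0 = m.comp P.d0)
    (h1 : P.d1.comp f1 = f0.comp P.d1) (h2 : P.d2.comp f2 = f1.comp P.d2)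
    (g : P.P2 →ₗ[R] Y) :
    P.κ Y (g.comp f2) = (Ext.mk₀ (ieh m)).comp (P.κ Y g) (zero_add 2) := by
  have hk : ∀ x : P.K, f0 (P.i x) ∈ LinearMap.ker P.d0 := by
    intro x
    rw [LinearMap.mem_ker]
    have := LinearMap.congr_fun h0 (P.i x)
    simp only [LinearMap.comp_apply] at this
    rw [this]
    have hx : P.d0 (P.i x) = 0 := x.2
    rw [hx, map_zero]
  let fk : P.K →ₗ[R] P.K := (f0.comp P.i).codRestrict (LinearMap.ker P.d0) hk
  have hfk : ∀ x, P.i (fk x) = f0 (P.i x) := fun x => rfl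
  have n1 := P.s1.nat P.s1 f2 f1 fk h2 (by
    ext x
    apply P.i_inj
    simp only [LinearMap.comp_apply]
    rw [hfk, i_p, i_p]; exact LinearMap.congr_fun h1 x)
  have n0 := P.s0.nat P.s0 fk f0 m (by ext x; exact hfk x) h0
  rw [κ, κ, ← ieh_comp, ← Ext.mk₀_comp_mk₀, ← Ext.comp_assoc_of_second_deg_zero, n1,
    Ext.comp_assoc_of_third_deg_zero, ← Ext.comp_assoc_of_second_deg_zero, n0]
  exact Ext.comp_assoc _ _ _ (zero_add 1) (by rfl : 1 + 1 = 2) (by rfl)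

end IeRes
end HomAlg

section HomAlgB
open CategoryTheory Abelian

variable {R : Type} [Ring R]

/-- resolution data from global dimension -/
lemma ie_res_exists (hgl : GlDimLE2 R) (M : ModuleCat.{0} R) : Nonempty (IeRes R M) := by
  obtain ⟨P2, P1, P0, d2, d1, d0, a, b, c, d, e, f, g⟩ := hgl M
  exact ⟨⟨P2, P1, P0, d2, d1, d0, a, b, c, d, e, f, g⟩⟩

lemma ie_ext3 (hgl : GlDimLE2 R) (M N : ModuleCat.{0} R) (x : Ext M N 3) : x = 0 := by
  obtain ⟨P⟩ := ie_res_exists hgl M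
  have := P.pd
  exact Ext.eq_zero_of_hasProjectiveDimensionLT x 3 le_rfl

/-- powers -/
def iePow (D : ModuleCat.{0} R) (n : ℕ) : ModuleCat.{0} R := ModuleCat.of R (Fin n → D)

/-- coordinate -/
def iePr (D : ModuleCat.{0} R) (n : ℕ) (i : Fin n) : iePow D n →ₗ[R] D :=
  LinearMap.proj (R := R) (φ := fun _ : Fin n => D) i

/-- inclusion of a coordinate -/
def ieIn (D : ModuleCat.{0} R) (n : ℕ) (i : Fin n) : D →ₗ[R] iePow D n :=
  LinearMap.single R (fun _ : Fin n => D) i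

lemma iePr_apply (D : ModuleCat.{0} R) (n : ℕ) (i : Fin n) (x : Fin n → D) :
    iePr D n i x = x i := rfl

lemma ie_sum_pow (D : ModuleCat.{0} R) (n : ℕ) :
    ∑ i, (ieIn D n i).comp (iePr D n i) = LinearMap.id := by
  refine LinearMap.ext fun x => ?_
  rw [LinearMap.sum_apply]
  exact LinearMap.sum_single_apply (fun _ : Fin n => D) x

lemma ie_pow_ext (D W : ModuleCat.{0} R) (n : ℕ) (m : ℕ) (x : Ext (iePow D n) W m) :
    x = ∑ i, (Ext.mk₀ (ieh (iePr D n i))).comp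
      ((Ext.mk₀ (ieh (ieIn D n i))).comp x (zero_add m)) (zero_add m) := by
  have h : Ext.mk₀ (ieh (LinearMap.id : iePow D n →ₗ[R] iePow D n)) =
    ∑ i, Ext.mk₀ (ieh (iePr D n i) ≫ ieh (ieIn D n i)) := by
    rw [← ie_sum_pow, ieh_sum, Ext.mk₀_sum]
    rfl
  have h2 : (Ext.mk₀ (ieh (LinearMap.id : iePow D n →ₗ[R] iePow D n))).comp x (zero_add m) = x :=
    Ext.mk₀_id_comp x
  conv_lhs => rw [← h2, h, Ext.sum_comp]
  refine Finset.sum_congr rfl fun i _ => ?_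
  rw [Ext.mk₀_comp_mk₀_assoc]

lemma ie_pow_ext_zero {D W : ModuleCat.{0} R} {m : ℕ} (h : ∀ x : Ext D W m, x = 0) (n : ℕ)
    (x : Ext (iePow D n) W m) : x = 0 := by
  rw [ie_pow_ext D W n m x]
  exact Finset.sum_eq_zero fun i _ => by rw [h (Ext.comp _ _ _), Ext.comp_zero]

lemma ie_sub_ses {M : ModuleCat.{0} R} (N : Submodule R M) :
    IeSes (X := ModuleCat.of R N) (Y := M) (Z := ModuleCat.of R (M ⧸ N)) N.subtype N.mkQ :=
  ⟨Subtype.val_injective, Submodule.mkQ_surjective N, by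
    rw [Submodule.range_subtype, Submodule.ker_mkQ]⟩

/-- an injective map gives a short exact sequence -/
lemma ie_inj_ses {X M : ModuleCat.{0} R} (f : X →ₗ[R] M) (hf : Function.Injective f) :
    IeSes (X := X) (Y := M) (Z := ModuleCat.of R (M ⧸ LinearMap.range f)) f
      (LinearMap.range f).mkQ :=
  ⟨hf, Submodule.mkQ_surjective _, by rw [Submodule.ker_mkQ]⟩

lemma ie_ker_ses {X M : ModuleCat.{0} R} (f : X →ₗ[R] M) (hf : Function.Surjective f) :
    IeSes (X := ModuleCat.of R (LinearMap.ker f)) (Y := X) (Z := M) (LinearMap.ker f).subtype f :=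
  ⟨Subtype.val_injective, hf, by rw [Submodule.range_subtype]⟩

/-- restriction to a submodule is surjective on Ext² -/
lemma ie_ext2_restr (hgl : GlDimLE2 R) {X Y Z W : ModuleCat.{0} R} {f : X →ₗ[R] Y}
    {g : Y →ₗ[R] Z} (h : IeSes f g) (x : Ext X W 2) :
    ∃ y : Ext Y W 2, (Ext.mk₀ (ieh f)).comp y (zero_add 2) = x :=
  h.contra1 x (n₁ := 3) rfl (ie_ext3 hgl _ _ _)

lemma ie_idle1 (hgl : GlDimLE2 R) (D M : ModuleCat.{0} R)
    (hD : ∀ J : Ideal R, ∃ (n : ℕ) (f : (R ⧸ J) →ₗ[R] (Fin n → D)), Function.Injective f)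
    (h : ∀ x : Ext D M 2, x = 0) : IdLE1 R M := by
  obtain ⟨I⟩ := EnoughInjectives.presentation M
  let I0 : ModuleCat.{0} R := I.J
  have hI0 : Injective I0 := I.injective
  let d : M →ₗ[R] I0 := I.f.hom
  have hd : Function.Injective d := (ModuleCat.mono_iff_injective I.f).mp I.mono
  have s' := ie_inj_ses d hd
  refine ⟨I0, ModuleCat.of R (I0 ⧸ LinearMap.range d), d, (LinearMap.range d).mkQ,
    (Module.injective_iff_injective_object R I0).mpr hI0, ?_, s'.inj, s'.surj, s'.ex⟩
  apply Module.Baer.injective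
  intro J g
  obtain ⟨n, f, hf⟩ := hD J
  have s := ie_sub_ses (M := ModuleCat.of R R) J
  have t := ie_inj_ses (X := ModuleCat.of R (R ⧸ J)) (M := iePow D n) f hf
  have e2 : ∀ x : Ext (ModuleCat.of R (R ⧸ J)) M 2, x = 0 := by
    intro x
    obtain ⟨y, rfl⟩ := ie_ext2_restr hgl t x
    rw [ie_pow_ext_zero h n y, Ext.comp_zero]
  have e1 : ∀ x : Ext (ModuleCat.of R (R ⧸ J)) (ModuleCat.of R (I0 ⧸ LinearMap.range d)) 1,
      x = 0 := by
    intro x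
    obtain ⟨y, rfl⟩ := s'.cov3 x (n₁ := 2) rfl (e2 _)
    rw [Ext.eq_zero_of_injective y, Ext.zero_comp]
  obtain ⟨w, hw⟩ := s.contra1 (W := ModuleCat.of R (I0 ⧸ LinearMap.range d)) (n₀ := 0)
    (Ext.mk₀ (ieh g)) (n₁ := 1) rfl (e1 _)
  obtain ⟨f, rfl⟩ := (Ext.mk₀_bijective _ _).2 w
  obtain ⟨f, rfl⟩ := ieh_surj f
  rw [Ext.mk₀_comp_mk₀] at hw
  have := (Ext.mk₀_bijective _ _).1 hw
  rw [ieh_comp] at this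
  have := ieh_inj this
  exact ⟨f, fun x hx => LinearMap.congr_fun this ⟨x, hx⟩⟩

lemma ie_idle1_ext (D M : ModuleCat.{0} R) (h : IdLE1 R M) (x : Ext D M 2) : x = 0 := by
  have := ie_id1 h
  exact Ext.eq_zero_of_hasInjectiveDimensionLT x 2 le_rfl

lemma ie_pdle1_ext (M N : ModuleCat.{0} R) (h : PdLE1 R M) (x : Ext M N 2) : x = 0 := by
  have := ie_pd1 h
  exact Ext.eq_zero_of_hasProjectiveDimensionLT x 2 le_rfl

lemma ie_pdle1 [IsNoetherianRing R] (hgl : GlDimLE2 R) (M : ModuleCat.{0} R) [Module.Finite R M]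
    (h : ∀ x : Ext M (ModuleCat.of R R) 2, x = 0) : PdLE1 R M := by
  obtain ⟨a, d0, hd0⟩ := Module.Finite.exists_fin' R M
  have : Module.Finite R (LinearMap.ker d0) := inferInstance
  obtain ⟨b, p, hp⟩ := Module.Finite.exists_fin' R (LinearMap.ker d0)
  let P0 : ModuleCat.{0} R := ModuleCat.of R (Fin a → R)
  let P1 : ModuleCat.{0} R := ModuleCat.of R (Fin b → R)
  let K1 : ModuleCat.{0} R := ModuleCat.of R (LinearMap.ker d0)
  let P2 : ModuleCat.{0} R := ModuleCat.of R (LinearMap.ker p)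
  have hP0 : Module.Projective R P0 := inferInstanceAs (Module.Projective R (Fin a → R))
  have hP1 : Module.Projective R P1 := inferInstanceAs (Module.Projective R (Fin b → R))
  have pP0 := ie_proj hP0
  have pP1 := ie_proj hP1
  have s0 : IeSes (X := K1) (Y := P0) (Z := M) (LinearMap.ker d0).subtype d0 :=
    ie_ker_ses (X := P0) d0 hd0
  have s1 : IeSes (X := P2) (Y := P1) (Z := K1) (LinearMap.ker p).subtype p :=
    ie_ker_ses (X := P1) (M := K1) p hp
  obtain ⟨Q⟩ := ie_res_exists hgl M
  have pdM := Q.pd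
  have pdK1 : HasProjectiveDimensionLT K1 2 :=
    s0.pd1 2 (inferInstanceAs (HasProjectiveDimensionLT P0 2)) pdM
  have pdP2 : HasProjectiveDimensionLT P2 1 :=
    s1.pd1 1 (inferInstanceAs (HasProjectiveDimensionLT P1 1)) pdK1
  have hP2 : Module.Projective R P2 :=
    (IsProjective.iff_projective P2).mpr (projective_iff_hasProjectiveDimensionLT_one |>.mpr pdP2)
  let P : IeRes R M :=
    { P2 := P2, P1 := P1, P0 := P0, d2 := (LinearMap.ker p).subtype
      d1 := (LinearMap.ker d0).subtype.comp p
      d0 := d0, p2 := hP2, p1 := hP1, p0 := hP0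
      inj := Subtype.val_injective
      surj := hd0
      e1 := by
        rw [Submodule.range_subtype, LinearMap.ker_comp, Submodule.ker_subtype]; rfl
      e0 := by
        rw [LinearMap.range_comp, LinearMap.range_eq_top.mpr hp, Submodule.map_top,
          Submodule.range_subtype] }
  have key : ∀ g : P2 →ₗ[R] R, ∃ f : P1 →ₗ[R] R, g = f.comp (LinearMap.ker p).subtype :=
    fun g => (P.κ_eq_zero (ModuleCat.of R R) g).mp (h _)
  -- `P2` is a retract of a free module
  have : Module.Finite R P2 := inferInstanceAs (Module.Finite R (LinearMap.ker p))
  obtain ⟨n, r, hr⟩ := Module.Finite.exists_fin' R P2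
  obtain ⟨s, hs⟩ := Module.projective_lifting_property r LinearMap.id hr
  choose F hF using fun i : Fin n => key ((LinearMap.proj i).comp s)
  let ret : P1 →ₗ[R] P2 := r.comp (LinearMap.pi F)
  have hret : ret.comp (LinearMap.ker p).subtype = LinearMap.id := by
    rw [← hs]
    ext1 x
    change r _ = r _
    congr 1
    funext i
    exact (LinearMap.congr_fun (hF i) x).symm
  -- so `K1` is projective
  have hK1 : Module.Projective R K1 := by
    have hk : ∀ x : P1, p x = 0 → ((LinearMap.id : P1 →ₗ[R] P1) -
        (LinearMap.ker p).subtype.comp ret) x = 0 := by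
      intro x hx
      have := LinearMap.congr_fun hret ⟨x, hx⟩
      have h2 : ret x = ⟨x, hx⟩ := this
      change x - ((ret x : LinearMap.ker p) : Fin b → R) = 0
      rw [h2]; exact sub_self x
    let e : ((P1 : Type) ⧸ LinearMap.ker p) ≃ₗ[R] K1 := p.quotKerEquivOfSurjective hp
    let l : K1 →ₗ[R] P1 := ((LinearMap.ker p).liftQ ((LinearMap.id : P1 →ₗ[R] P1) -
        (LinearMap.ker p).subtype.comp ret) hk).comp e.symm.toLinearMap
    refine Module.Projective.of_split (M := P1) l p ?_
    ext1 y
    obtain ⟨x, rfl⟩ := hp y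
    have he : e.symm (p x) = Submodule.Quotient.mk x := by
      rw [LinearEquiv.symm_apply_eq]; rfl
    change p (Submodule.liftQ _ _ hk (e.symm (p x))) = p x
    rw [he]
    change p (x - ((ret x : LinearMap.ker p) : Fin b → R)) = p x
    rw [map_sub, (ret x).2, sub_zero]
  exact ⟨K1, P0, (LinearMap.ker d0).subtype, d0, hK1, hP0, s0.inj, s0.surj, s0.ex⟩

end HomAlgB

section DualPart

variable {k : Type} [Field k] {C : Type} [Ring C] [Algebra k C]

/-- the pairing exhibiting `DC` as the dual of `C` -/
structure IeDual (k : Type) [Field k] {C : Type} [Ring C] [Algebra k C] {DC : ModuleCat.{0} Cᵐᵒᵖ}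
    (φ : DC → C → k) : Prop where
  addl : ∀ n n' m, φ (n + n') m = φ n m + φ n' m
  addr : ∀ n m m', φ n (m + m') = φ n m + φ n m'
  smulr : ∀ (c : k) n m, φ n ((algebraMap k C c) * m) = c * φ n m
  bal : ∀ (a : C) n m, φ (op a • n) m = φ n (a * m)
  nd1 : ∀ n, (∀ m, φ n m = 0) → n = 0
  nd2 : ∀ m, (∀ n, φ n m = 0) → m = 0

namespace IeDual
variable {DC : ModuleCat.{0} Cᵐᵒᵖ} {φ : DC → C → k}

/-- additive in the first variable -/
def al (h : IeDual k φ) (c : C) : DC →+ k := AddMonoidHom.mk' (fun n => φ n c) (fun n n' => h.addl n n' c)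

lemma al_apply (h : IeDual k φ) (c : C) (n : DC) : h.al c n = φ n c := rfl

/-- linear in the second variable -/
def fn (h : IeDual k φ) (n : DC) : C →ₗ[k] k where
  toFun := φ n
  map_add' := h.addr n
  map_smul' t c := by
    rw [Algebra.smul_def, h.smulr]; rfl

lemma fn_apply (h : IeDual k φ) (n : DC) (c : C) : h.fn n c = φ n c := rfl

lemma ext (h : IeDual k φ) {n n' : DC} (hn : ∀ m, φ n m = φ n' m) : n = n' := by
  rw [← sub_eq_zero]
  apply h.nd1
  intro m
  rw [← h.al_apply, map_sub, h.al_apply, h.al_apply, hn, sub_self]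

lemma zl (h : IeDual k φ) (c : C) : φ 0 c = 0 := (h.al c).map_zero

lemma rep [FiniteDimensional k C] (h : IeDual k φ) (l : C →ₗ[k] k) :
    ∃ n : DC, ∀ c, φ n c = l c := by
  let V : Submodule k (Module.Dual k C) :=
    { carrier := {l | ∃ n : DC, ∀ c, φ n c = l c}
      zero_mem' := ⟨0, fun c => h.zl c⟩
      add_mem' := by
        rintro a b ⟨n, hn⟩ ⟨n', hn'⟩
        exact ⟨n + n', fun c => by rw [h.addl, hn, hn']; rfl⟩
      smul_mem' := by
        rintro t a ⟨n, hn⟩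
        exact ⟨op (algebraMap k C t) • n, fun c => by rw [h.bal, h.smulr, hn]; rfl⟩ }
  have hV : V.dualCoannihilator = ⊥ := by
    rw [eq_bot_iff]
    intro c hc
    rw [Submodule.mem_dualCoannihilator] at hc
    exact h.nd2 c fun n => hc (h.fn n) ⟨n, fun c => rfl⟩
  have h2 := Subspace.dualCoannihilator_dualAnnihilator_eq (W := V)
  rw [hV, Submodule.dualAnnihilator_bot] at h2
  have : l ∈ V := h2 ▸ Submodule.mem_top
  exact this

lemma mkHom [FiniteDimensional k C] (h : IeDual k φ) {L : Type} [AddCommGroup L] [Module Cᵐᵒᵖ L]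
    (θ : L → k) (h1 : ∀ x y, θ (x + y) = θ x + θ y)
    (h2 : ∀ (t : k) x, θ (op (algebraMap k C t) • x) = t * θ x) :
    ∃ f : L →ₗ[Cᵐᵒᵖ] DC, ∀ x c, φ (f x) c = θ (op c • x) := by
  choose f hf using fun x : L => h.rep
    { toFun := fun c => θ (op c • x)
      map_add' := fun c c' => by rw [MulOpposite.op_add, add_smul, h1]
      map_smul' := fun t c => by
        rw [Algebra.smul_def, Algebra.commutes, op_mul, mul_smul, h2]; rfl }
  have hf' : ∀ x c, φ (f x) c = θ (op c • x) := hf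
  refine ⟨⟨⟨f, ?_⟩, ?_⟩, hf⟩
  · intro x y
    refine h.ext fun c => ?_
    rw [h.addl, hf', hf', hf', smul_add, h1]
  · intro a x
    refine h.ext fun c => ?_
    induction a using MulOpposite.rec' with | _ a =>
    change φ (f _) c = φ (op a • f x) c
    rw [h.bal, hf', hf', op_mul, mul_smul]

lemma cogen [FiniteDimensional k C] (h : IeDual k φ) (L : Type) [AddCommGroup L] [Module Cᵐᵒᵖ L]
    [Module.Finite Cᵐᵒᵖ L] :
    ∃ (n : ℕ) (f : L →ₗ[Cᵐᵒᵖ] (Fin n → DC)), Function.Injective f := by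
  let _ : Module k L := Module.compHom L (algebraMap k Cᵐᵒᵖ)
  have : IsScalarTower k Cᵐᵒᵖ L := ⟨fun t c x => by
    rw [Algebra.smul_def, mul_smul]; rfl⟩
  have : Module.Finite k Cᵐᵒᵖ := Module.Finite.equiv (MulOpposite.opLinearEquiv k : C ≃ₗ[k] Cᵐᵒᵖ)
  have : Module.Finite k L := Module.Finite.trans Cᵐᵒᵖ L
  let b := Module.finBasis k L
  choose f hf using fun i => h.mkHom (L := L) (fun x => b.coord i x)
    (fun x y => map_add _ x y) (fun t x => (map_smul (b.coord i) t x))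
  refine ⟨_, LinearMap.pi f, ?_⟩
  rw [injective_iff_map_eq_zero]
  intro x hx
  refine b.ext_elem fun i => ?_
  have := hf i x 1
  have h0 : f i x = 0 := congrFun hx i
  rw [h0, h.zl, op_one, one_smul] at this
  rw [map_zero]
  exact this.symm

lemma endo [FiniteDimensional k C] (h : IeDual k φ) (a : DC →ₗ[Cᵐᵒᵖ] DC) :
    ∃ c, ∀ n x, φ (a n) x = φ n (x * c) := by
  choose r hr using h.rep
  have hr' : ∀ n, r (h.fn n) = n := fun n => h.ext fun m => by rw [hr]; rfl
  let F : Module.Dual k (Module.Dual k C) :=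
    { toFun := fun l => φ (a (r l)) 1
      map_add' := fun l l' => by
        have : r (l + l') = r l + r l' := h.ext fun m => by
          rw [hr, h.addl, hr, hr]; rfl
        rw [this, map_add, h.addl]
      map_smul' := fun t l => by
        have : r (t • l) = op (algebraMap k C t) • r l := h.ext fun m => by
          rw [hr, h.bal, h.smulr, hr]; rfl
        rw [this, map_smul, h.bal, h.smulr]; rfl }
  have hc1 : ∃ c, Module.evalEquiv k C c = F := (Module.evalEquiv k C).surjective F
  obtain ⟨c, hc⟩ := hc1
  have key : ∀ n, φ (a n) 1 = φ n c := by
    intro n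
    have := LinearMap.congr_fun hc (h.fn n)
    have h3 : F (h.fn n) = φ (a n) 1 := by
      change φ (a (r (h.fn n))) 1 = _
      rw [hr']
    rw [h3] at this
    exact this.symm
  refine ⟨c, fun n x => ?_⟩
  rw [← h.bal, ← key, map_smul, h.bal, mul_one]

lemma fin [FiniteDimensional k C] (h : IeDual k φ) : Module.Finite Cᵐᵒᵖ DC := by
  let _ : Module k DC := Module.compHom DC (algebraMap k Cᵐᵒᵖ)
  have : IsScalarTower k Cᵐᵒᵖ DC := ⟨fun t c x => by
    rw [Algebra.smul_def, mul_smul]; rfl⟩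
  let F : DC →ₗ[k] Module.Dual k C :=
    { toFun := h.fn
      map_add' := fun n n' => LinearMap.ext fun c => h.addl n n' c
      map_smul' := fun t n => LinearMap.ext fun c => by
        change φ (op (algebraMap k C t) • n) c = t * φ n c
        rw [h.bal, h.smulr] }
  have hF : Function.Injective F := fun n n' e => h.ext fun m => LinearMap.congr_fun e m
  have : Module.Finite k DC := Module.Finite.of_injective F hF
  exact Module.Finite.of_restrictScalars_finite k Cᵐᵒᵖ DC

end IeDual
end DualPart

section RelPart
open Abelian

/-- bundled data of `E = Ext²(DC, C)` -/
structure IeRel (k : Type) [Field k] (C : Type) [Ring C] [Algebra k C]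
    (E : Type) [AddCommGroup E] [Module C E] [Module Cᵐᵒᵖ E] where
  DC : ModuleCat.{0} Cᵐᵒᵖ
  φ : DC → C → k
  dual : IeDual k φ
  P : IeRes Cᵐᵒᵖ DC
  q : (P.P2 →ₗ[Cᵐᵒᵖ] C) →ₗ[C] E
  qs : Function.Surjective q
  q0 : ∀ g : P.P2 →ₗ[Cᵐᵒᵖ] C, q g = 0 ↔ ∃ f : P.P1 →ₗ[Cᵐᵒᵖ] C, g = f.comp P.d2
  act : ∀ c : C, ∃ (μ : DC →ₗ[Cᵐᵒᵖ] DC) (f0 : P.P0 →ₗ[Cᵐᵒᵖ] P.P0)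
            (f1 : P.P1 →ₗ[Cᵐᵒᵖ] P.P1) (f2 : P.P2 →ₗ[Cᵐᵒᵖ] P.P2),
          (∀ n x, φ (μ n) x = φ n (x * c)) ∧
          P.d0.comp f0 = μ.comp P.d0 ∧
          P.d1.comp f1 = f0.comp P.d1 ∧
          P.d2.comp f2 = f1.comp P.d2 ∧
          ∀ g : P.P2 →ₗ[Cᵐᵒᵖ] C, q (g.comp f2) = op c • q g

variable {k : Type} [Field k] {C : Type} [Ring C] [Algebra k C]
    {E : Type} [AddCommGroup E] [Module C E] [Module Cᵐᵒᵖ E]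

lemma ie_rel (hE : IsRelExt k C E) : Nonempty (IeRel k C E) := by
  obtain ⟨DC, φ, h1, h2, h3, h4, h5, h6, P2, P1, P0, d2, d1, d0, a, b, c, d, e, f, g, q, qs, q0,
    act⟩ := hE
  exact ⟨⟨DC, φ, ⟨h1, h2, h3, h4, h5, h6⟩, ⟨P2, P1, P0, d2, d1, d0, a, b, c, d, e, f, g⟩, q, qs, q0,
    act⟩⟩

/-- the regular right module -/
abbrev ieA (C : Type) [Ring C] : ModuleCat.{0} Cᵐᵒᵖ := ModuleCat.of Cᵐᵒᵖ C

namespace IeRel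

lemma kE_exists (r : IeRel k C E) : ∃ K : E →+ Ext r.DC (ieA C) 2,
    Function.Bijective K ∧ ∀ (c : C) (a : r.DC →ₗ[Cᵐᵒᵖ] r.DC),
      (∀ n x, r.φ (a n) x = r.φ n (x * c)) →
      ∀ e, K (op c • e) = (Ext.mk₀ (ieh a)).comp (K e) (zero_add 2) := by
  let K0 : (r.P.P2 →ₗ[Cᵐᵒᵖ] C) →+ Ext r.DC (ieA C) 2 :=
    AddMonoidHom.mk' (fun g => r.P.κ (ieA C) g) (fun g h => r.P.κ_add (ieA C) g h)
  have hK0 : ∀ g, K0 g = 0 ↔ r.q g = 0 := fun g =>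
    (r.P.κ_eq_zero (ieA C) g).trans (r.q0 g).symm
  have hK1 : ∀ g h, K0 g = K0 h ↔ r.q g = r.q h := fun g h => by
    rw [← sub_eq_zero, ← map_sub, hK0, map_sub, sub_eq_zero]
  choose s hs using r.qs
  refine ⟨AddMonoidHom.mk' (fun e => K0 (s e)) (fun e e' => ?_), ⟨?_, ?_⟩, ?_⟩
  · rw [← map_add, hK1, map_add, hs, hs, hs]
  · intro e e' h
    have h' : K0 (s e) = K0 (s e') := h
    rw [hK1, hs, hs] at h'
    exact h'
  · intro y
    obtain ⟨g, hg⟩ := r.P.κ_surj (ieA C) y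
    refine ⟨r.q g, ?_⟩
    rw [← hg]
    change K0 _ = K0 _
    rw [hK1, hs]
  · intro c a ha e
    obtain ⟨μ, f0, f1, f2, hμ, h0, h1, h2, hq⟩ := r.act c
    have hμa : μ = a := LinearMap.ext fun n => r.dual.ext fun x => by rw [hμ, ha]
    subst hμa
    have := r.P.κ_nat (ieA C) μ f0 f1 f2 h0 h1 h2 (s e)
    refine Eq.trans ?_ this
    change K0 _ = K0 _
    rw [hK1, hs, hq, hs]

end IeRel

/-- components of a map of powers -/
lemma ie_comp_apply {R : Type} [Ring R] {D : ModuleCat.{0} R} {n m : ℕ}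
    (A : iePow D n →ₗ[R] iePow D m) (y : Fin n → D) (j : Fin m) :
    (A y : Fin m → D) j = ∑ i, ((iePr D m j).comp (A.comp (ieIn D n i))) (y i) := by
  have h : ∀ z : iePow D n, ∑ i, ieIn D n i (iePr D n i z) = z := fun z => by
    have := LinearMap.congr_fun (ie_sum_pow D n) z
    rw [LinearMap.sum_apply] at this
    exact this
  have h' : ∑ i, ieIn D n i (y i) = (y : iePow D n) := h y
  change iePr D m j (A y) = ∑ i, (iePr D m j) (A (ieIn D n i (y i)))
  conv_lhs => rw [← h', map_sum, map_sum]

lemma ie_pr_in {R : Type} [Ring R] {D : ModuleCat.{0} R} {n : ℕ} (i l : Fin n) :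
    (iePr D n i).comp (ieIn D n l) = if i = l then LinearMap.id else 0 := by
  ext x
  change (Pi.single l x : Fin n → D) i = _
  rw [Pi.single_apply]
  split_ifs <;> rfl

lemma ie_T_in {R : Type} [Ring R] {D W : ModuleCat.{0} R} {n m : ℕ} (y : Fin n → Ext D W m)
    (l : Fin n) : (Ext.mk₀ (ieh (ieIn D n l))).comp
      (∑ i, (Ext.mk₀ (ieh (iePr D n i))).comp (y i) (zero_add m)) (zero_add m) = y l := by
  rw [Ext.comp_sum, Finset.sum_eq_single l]
  · rw [Ext.mk₀_comp_mk₀_assoc, ieh_comp, ie_pr_in, if_pos rfl]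
    exact Ext.mk₀_id_comp _
  · intro i _ hi
    rw [Ext.mk₀_comp_mk₀_assoc, ieh_comp, ie_pr_in, if_neg hi, ieh_zero, Ext.mk₀_zero,
      Ext.zero_comp]
  · simp

namespace IeRel
variable [FiniteDimensional k C]

/-- vector version -/
lemma vec (r : IeRel k C E) {n m : ℕ} (A : iePow r.DC n →ₗ[Cᵐᵒᵖ] iePow r.DC m)
    (c : Fin m → Fin n → C)
    (hc : ∀ j i y x, r.φ ((iePr r.DC m j).comp (A.comp (ieIn r.DC n i)) y) x =
      r.φ y (x * c j i)) :
    ∃ (T : (Fin n → E) → Ext (iePow r.DC n) (ieA C) 2)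
      (T' : (Fin m → E) → Ext (iePow r.DC m) (ieA C) 2),
      Function.Bijective T ∧ Function.Surjective T' ∧
      ∀ e, (Ext.mk₀ (ieh A)).comp (T' e) (zero_add 2) = T (fun i => ∑ j, op (c j i) • e j) := by
  obtain ⟨K, hK, hact⟩ := r.kE_exists
  refine ⟨fun e => ∑ i, (Ext.mk₀ (ieh (iePr r.DC n i))).comp (K (e i)) (zero_add 2),
    fun e => ∑ i, (Ext.mk₀ (ieh (iePr r.DC m i))).comp (K (e i)) (zero_add 2), ⟨?_, ?_⟩, ?_, ?_⟩
  · intro e e' h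
    funext l
    apply hK.1
    have := congrArg (fun z => (Ext.mk₀ (ieh (ieIn r.DC n l))).comp z (zero_add 2)) h
    dsimp only at this
    rwa [ie_T_in, ie_T_in] at this
  · intro y
    choose e he using fun i => hK.2 ((Ext.mk₀ (ieh (ieIn r.DC n i))).comp y (zero_add 2))
    refine ⟨e, ?_⟩
    dsimp only
    simp only [he]
    exact (ie_pow_ext r.DC (ieA C) n 2 y).symm
  · intro y
    choose e he using fun i => hK.2 ((Ext.mk₀ (ieh (ieIn r.DC m i))).comp y (zero_add 2))
    refine ⟨e, ?_⟩
    dsimp only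
    simp only [he]
    exact (ie_pow_ext r.DC (ieA C) m 2 y).symm
  · intro e
    dsimp only
    conv_lhs => rw [ie_pow_ext r.DC (ieA C) n 2 (Ext.comp _ _ _)]
    refine Finset.sum_congr rfl fun i _ => ?_
    congr 1
    rw [map_sum, Ext.comp_sum, Ext.comp_sum]
    refine Finset.sum_congr rfl fun j _ => ?_
    rw [hact (c j i) _ (hc j i), Ext.mk₀_comp_mk₀_assoc, Ext.mk₀_comp_mk₀_assoc, ieh_comp,
      ieh_comp]

lemma ext_iff_surj (hgl : GlDimLE2 Cᵐᵒᵖ) (r : IeRel k C E) {n m : ℕ}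
    (A : iePow r.DC n →ₗ[Cᵐᵒᵖ] iePow r.DC m)
    (c : Fin m → Fin n → C)
    (hc : ∀ j i y x, r.φ ((iePr r.DC m j).comp (A.comp (ieIn r.DC n i)) y) x =
      r.φ y (x * c j i)) (M Q : ModuleCat.{0} Cᵐᵒᵖ) (ι : M →ₗ[Cᵐᵒᵖ] iePow r.DC n)
    (π : iePow r.DC n →ₗ[Cᵐᵒᵖ] Q) (s : IeSes ι π) (ι' : Q →ₗ[Cᵐᵒᵖ] iePow r.DC m)
    (hι' : Function.Injective ι') (hA : A = ι'.comp π) :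
    (∀ x : Ext M (ieA C) 2, x = 0) ↔
      ∀ e : Fin n → E, ∃ e' : Fin m → E, e = fun i => ∑ j, op (c j i) • e' j := by
  obtain ⟨T, T', hT, hT', hTT⟩ := r.vec A c hc
  constructor
  · intro h e
    obtain ⟨y, hy⟩ := s.contra2 (T e) (h _)
    obtain ⟨z, rfl⟩ := ie_ext2_restr hgl (ie_inj_ses ι' hι') y
    obtain ⟨e', rfl⟩ := hT' z
    refine ⟨e', hT.1 ?_⟩
    rw [← hTT, ← hy, hA, Ext.mk₀_comp_mk₀_assoc, ieh_comp]
  · intro h x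
    obtain ⟨y, rfl⟩ := ie_ext2_restr hgl s x
    obtain ⟨e, rfl⟩ := hT.2 y
    obtain ⟨e', rfl⟩ := h e
    rw [← hTT, Ext.mk₀_comp_mk₀_assoc, ieh_comp]
    have : A.comp ι = 0 := by
      ext1 x
      rw [hA]
      have : ι x ∈ LinearMap.ker π := s.ex ▸ LinearMap.mem_range_self ι x
      rw [LinearMap.mem_ker] at this
      change ι' (π (ι x)) = 0
      rw [this, map_zero]
    rw [this, ieh_zero, Ext.mk₀_zero, Ext.zero_comp]

lemma hom_zero_of_surj (r : IeRel k C E) {n m : ℕ}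
    (A : iePow r.DC n →ₗ[Cᵐᵒᵖ] iePow r.DC m)
    (c : Fin m → Fin n → C)
    (hc : ∀ j i y x, r.φ ((iePr r.DC m j).comp (A.comp (ieIn r.DC n i)) y) x =
      r.φ y (x * c j i)) (M : ModuleCat.{0} Cᵐᵒᵖ) (ι : M →ₗ[Cᵐᵒᵖ] iePow r.DC n)
    (hι : Function.Injective ι) (hA : ∀ x, A (ι x) = 0)
    (hs : ∀ e : Fin n → E, ∃ e' : Fin m → E, e = fun i => ∑ j, op (c j i) • e' j)
    (f : E →ₗ[Cᵐᵒᵖ] M) : f = 0 := by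
  let F : (i : Fin n) → E →ₗ[Cᵐᵒᵖ] r.DC := fun i => (iePr r.DC n i).comp (ι.comp f)
  have h1 : ∀ e' : Fin m → E, ∑ i, r.φ (F i (∑ j, op (c j i) • e' j)) 1 = 0 := by
    intro e'
    have h2 : ∀ i, r.φ (F i (∑ j, op (c j i) • e' j)) 1 =
        ∑ j, r.φ ((iePr r.DC m j).comp (A.comp (ieIn r.DC n i)) (F i (e' j))) 1 := by
      intro i
      rw [map_sum, ← r.dual.al_apply, map_sum]
      refine Finset.sum_congr rfl fun j _ => ?_
      rw [r.dual.al_apply, map_smul, r.dual.bal, hc, one_mul, mul_one]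
    simp only [h2]
    rw [Finset.sum_comm]
    refine Finset.sum_eq_zero fun j _ => ?_
    have h3 := ie_comp_apply A (ι (f (e' j))) j
    rw [hA] at h3
    simp only [← r.dual.al_apply]
    rw [← map_sum]
    refine Eq.trans (congrArg (r.dual.al 1) h3.symm) ?_
    exact map_zero (r.dual.al 1)
  have h4 : ∀ i e, r.φ (F i e) 1 = 0 := by
    intro i e
    obtain ⟨e', he'⟩ := hs (Pi.single i e)
    have := h1 e'
    rw [Finset.sum_eq_single i] at this
    · have h5 := congrFun he' i
      rw [Pi.single_eq_same] at h5
      rwa [← h5] at this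
    · intro l _ hl
      have h5 := congrFun he' l
      rw [Pi.single_eq_of_ne hl] at h5
      rw [← h5, map_zero, r.dual.zl]
    · simp
  ext1 e
  apply hι
  rw [LinearMap.zero_apply, map_zero]
  have h6 : ∀ i, F i e = 0 := fun i => r.dual.nd1 _ fun x => by
    have := h4 i (op x • e)
    rwa [map_smul, r.dual.bal, mul_one] at this
  exact funext h6

lemma surj_of_hom_zero [Module k E] [IsScalarTower k Cᵐᵒᵖ E] (r : IeRel k C E) {n m : ℕ}
    (A : iePow r.DC n →ₗ[Cᵐᵒᵖ] iePow r.DC m)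
    (c : Fin m → Fin n → C)
    (hc : ∀ j i y x, r.φ ((iePr r.DC m j).comp (A.comp (ieIn r.DC n i)) y) x =
      r.φ y (x * c j i)) (M : ModuleCat.{0} Cᵐᵒᵖ) (ι : M →ₗ[Cᵐᵒᵖ] iePow r.DC n)
    (hι : Function.Injective ι) (hA : ∀ y, A y = 0 → ∃ x, ι x = y)
    (hf : ∀ f : E →ₗ[Cᵐᵒᵖ] M, f = 0) :
    ∀ e : Fin n → E, ∃ e' : Fin m → E, e = fun i => ∑ j, op (c j i) • e' j := by
  have hsm : ∀ (t : k) (e : E), op (algebraMap k C t) • e = t • e := fun t e => by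
    have := smul_assoc t (1 : Cᵐᵒᵖ) e
    rw [one_smul, Algebra.smul_def, mul_one] at this
    exact this
  have hcomm : ∀ (t : k) (a : Cᵐᵒᵖ) (e : E), a • t • e = t • a • e := fun t a e => by
    rw [← hsm, ← hsm, ← mul_smul, ← mul_smul]
    congr 1
    exact (Algebra.commutes (A := Cᵐᵒᵖ) t a).symm
  let a : (Fin m → E) →ₗ[k] (Fin n → E) :=
    { toFun := fun e' i => ∑ j, op (c j i) • e' j
      map_add' := fun e e' => by
        funext i
        simp only [Pi.add_apply, smul_add, Finset.sum_add_distrib]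
      map_smul' := fun t e => by
        funext i
        simp only [Pi.smul_apply, hcomm, Finset.smul_sum, RingHom.id_apply] }
  by_contra! hns
  have hlt : LinearMap.range a < ⊤ := by
    rw [lt_top_iff_ne_top]
    intro htop
    rw [LinearMap.range_eq_top] at htop
    obtain ⟨e, he⟩ := hns
    obtain ⟨e', he'⟩ := htop e
    exact he e' he'.symm
  obtain ⟨θ, hθ, hle⟩ := Submodule.exists_le_ker_of_lt_top _ hlt
  choose f hfφ using fun i : Fin n => r.dual.mkHom (L := E) (fun x => θ (Pi.single i x))
    (fun x y => by rw [Pi.single_add, map_add]) (fun t x => by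
      rw [hsm, Pi.single_smul, map_smul, smul_eq_mul])
  let F : E →ₗ[Cᵐᵒᵖ] iePow r.DC n := LinearMap.pi f
  have hF0 : ∀ e, A (F e) = 0 := by
    intro e
    refine funext fun j => r.dual.nd1 _ fun x => ?_
    rw [ie_comp_apply A (F e) j, ← r.dual.al_apply, map_sum]
    have h1 : ∀ i, r.dual.al x (((iePr r.DC m j).comp (A.comp (ieIn r.DC n i))) (f i e)) =
        θ (Pi.single i (op (c j i) • op x • e)) := fun i => by
      rw [r.dual.al_apply, hc, hfφ, op_mul, mul_smul]
    refine Eq.trans (Finset.sum_congr rfl fun i _ => h1 i) ?_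
    rw [← map_sum]
    have h2 : a (Pi.single j (op x • e)) ∈ LinearMap.ker θ := hle (LinearMap.mem_range_self a _)
    rw [LinearMap.mem_ker] at h2
    rw [← h2]
    congr 1
    funext i
    rw [Finset.univ_sum_single]
    change _ = ∑ l, op (c l i) • (Pi.single j (op x • e) : Fin m → E) l
    rw [Finset.sum_eq_single j]
    · rw [Pi.single_eq_same]
    · intro l _ hl
      rw [Pi.single_eq_of_ne hl, smul_zero]
    · simp
  choose g hg using fun e => hA (F e) (hF0 e)
  let g' : E →ₗ[Cᵐᵒᵖ] M :=
    { toFun := g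
      map_add' := fun x y => hι (by rw [map_add, hg, hg, hg, map_add])
      map_smul' := fun b x => hι (by rw [RingHom.id_apply, map_smul, hg, hg, map_smul]) }
  have hg0 : ∀ e, F e = 0 := fun e => by
    rw [← hg, show g e = 0 from LinearMap.congr_fun (hf g') e, map_zero]
  apply hθ
  refine LinearMap.pi_ext fun i x => ?_
  have h7 := hfφ i x 1
  have h8 : f i x = 0 := congrFun (hg0 x) i
  rw [h8, r.dual.zl, op_one, one_smul] at h7
  rw [← h7]; rfl

lemma ext_iff_hom_zero [Module k E] [IsScalarTower k Cᵐᵒᵖ E] (hgl : GlDimLE2 Cᵐᵒᵖ)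
    (r : IeRel k C E) (M : ModuleCat.{0} Cᵐᵒᵖ) [Module.Finite Cᵐᵒᵖ M] :
    (∀ x : Ext M (ieA C) 2, x = 0) ↔ ∀ f : E →ₗ[Cᵐᵒᵖ] M, f = 0 := by
  have := r.dual.fin
  obtain ⟨n, ι, hι⟩ := r.dual.cogen M
  let ι1 : M →ₗ[Cᵐᵒᵖ] iePow r.DC n := ι
  obtain ⟨m, ι', hι'⟩ := r.dual.cogen ((Fin n → r.DC) ⧸ LinearMap.range ι)
  have s := ie_inj_ses (M := iePow r.DC n) ι1 hι
  let A : iePow r.DC n →ₗ[Cᵐᵒᵖ] iePow r.DC m := ι'.comp (LinearMap.range ι).mkQ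
  choose c hc using fun (j : Fin m) (i : Fin n) =>
    r.dual.endo ((iePr r.DC m j).comp (A.comp (ieIn r.DC n i)))
  rw [r.ext_iff_surj hgl A c hc M _ ι1 _ s ι' hι' rfl]
  constructor
  · intro h f
    refine r.hom_zero_of_surj A c hc M ι1 hι (fun x => ?_) h f
    change ι' ((LinearMap.range ι).mkQ (ι x)) = 0
    have h1 : (LinearMap.range ι).mkQ (ι x) = 0 :=
      (Submodule.Quotient.mk_eq_zero _).mpr (LinearMap.mem_range_self ι x)
    rw [h1, map_zero]
  · refine r.surj_of_hom_zero A c hc M ι1 hι (fun y hy => ?_)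
    have h1 : (LinearMap.range ι).mkQ y = 0 := hι' (by rw [map_zero]; exact hy)
    exact (Submodule.Quotient.mk_eq_zero _).mp h1

end IeRel
end RelPart

section BalPart
open Abelian

variable {C : Type} [Ring C]

/-- `c ↦ m c` -/
def ieTo {M : Type} [AddCommGroup M] [Module Cᵐᵒᵖ M] (m : M) : C →ₗ[Cᵐᵒᵖ] M where
  toFun c := op c • m
  map_add' a b := by rw [MulOpposite.op_add, add_smul]
  map_smul' a b := by
    rw [RingHom.id_apply, ← mul_smul]; rfl

lemma ieTo_apply {M : Type} [AddCommGroup M] [Module Cᵐᵒᵖ M] (m : M) (c : C) :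
    ieTo m c = op c • m := rfl

/-- the map `C^n → M` given by `n` elements -/
def ieSpan {M : Type} [AddCommGroup M] [Module Cᵐᵒᵖ M] {n : ℕ} (m : Fin n → M) :
    (Fin n → C) →ₗ[Cᵐᵒᵖ] M := ∑ i, (ieTo (m i)).comp (LinearMap.proj i)

lemma ieSpan_apply {M : Type} [AddCommGroup M] [Module Cᵐᵒᵖ M] {n : ℕ} (m : Fin n → M)
    (y : Fin n → C) : ieSpan m y = ∑ i, op (y i) • m i := by
  rw [ieSpan, LinearMap.sum_apply]; rfl

lemma ie_gen (M : Type) [AddCommGroup M] [Module Cᵐᵒᵖ M] [Module.Finite Cᵐᵒᵖ M] :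
    ∃ (n : ℕ) (m : Fin n → M), Function.Surjective (ieSpan (C := C) m) := by
  obtain ⟨n, f, hf⟩ := Module.Finite.exists_fin' Cᵐᵒᵖ M
  refine ⟨n, fun i => f (Pi.single i 1), fun x => ?_⟩
  obtain ⟨y, rfl⟩ := hf x
  refine ⟨fun i => unop (y i), ?_⟩
  rw [ieSpan_apply, f.pi_apply_eq_sum_univ y]
  refine Finset.sum_congr rfl fun i _ => ?_
  rw [op_unop]
  congr 2
  funext j
  rw [Pi.single_apply]
  simp only [eq_comm]

/-- all balanced maps out of `M × E` vanish -/
def IeBalZero (C : Type) [Ring C] (E : Type) [AddCommGroup E] [Module C E]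
    (M : Type) [AddCommGroup M] [Module Cᵐᵒᵖ M] : Prop :=
  ∀ (N : Type) [AddCommGroup N] (β : M →+ E →+ N),
    (∀ (c : C) m e, β (op c • m) e = β m (c • e)) → ∀ m e, β m e = 0

variable {k : Type} [Field k] [Algebra k C]
    {E : Type} [AddCommGroup E] [Module C E] [Module Cᵐᵒᵖ E]

namespace IeRel

lemma balA [IsNoetherianRing Cᵐᵒᵖ] (r : IeRel k C E) {M : Type} [AddCommGroup M] [Module Cᵐᵒᵖ M]
    {N : Type} [AddCommGroup N] (β : M →+ E →+ N)
    (hβ : ∀ (c : C) m e, β (op c • m) e = β m (c • e)) {n : ℕ} (m : Fin n → M)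
    (f : Fin n → (r.P.P2 →ₗ[Cᵐᵒᵖ] C)) (hf : ∀ x, ∑ i, op (f i x) • m i = 0) :
    ∑ i, β (m i) (r.q (f i)) = 0 := by
  have := r.P.p2
  have : IsNoetherian Cᵐᵒᵖ C :=
    isNoetherian_of_linearEquiv (MulOpposite.opLinearEquiv Cᵐᵒᵖ : C ≃ₗ[Cᵐᵒᵖ] Cᵐᵒᵖ).symm
  let K := LinearMap.ker (ieSpan (C := C) m)
  obtain ⟨s, kk, hkk⟩ := ie_gen (C := C) K
  let F : r.P.P2 →ₗ[Cᵐᵒᵖ] K := (LinearMap.pi f).codRestrict K (fun x => by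
    rw [LinearMap.mem_ker, ieSpan_apply]; exact hf x)
  obtain ⟨H, hH⟩ := Module.projective_lifting_property _ F hkk
  let h : Fin s → (r.P.P2 →ₗ[Cᵐᵒᵖ] C) := fun j => (LinearMap.proj j).comp H
  have h1 : ∀ i, f i = ∑ j, ((kk j : Fin n → C) i) • h j := by
    intro i
    ext x
    have h2 : (F x : Fin n → C) = ((ieSpan kk (H x) : K) : Fin n → C) := by
      rw [← hH]; rfl
    rw [ieSpan_apply] at h2
    have h3 := congrFun h2 i
    rw [AddSubmonoidClass.coe_finsetSum, Finset.sum_apply] at h3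
    rw [LinearMap.sum_apply]
    exact h3
  have h4 : ∀ i, β (m i) (r.q (f i)) = ∑ j, β (op ((kk j : Fin n → C) i) • m i) (r.q (h j)) := by
    intro i
    rw [h1, map_sum, map_sum]
    refine Finset.sum_congr rfl fun j _ => ?_
    rw [map_smul, hβ]
  simp only [h4]
  rw [Finset.sum_comm]
  refine Finset.sum_eq_zero fun j _ => ?_
  rw [← AddMonoidHom.finsetSum_apply, ← map_sum]
  have h5 : ieSpan m (kk j : Fin n → C) = 0 := (kk j).2
  rw [ieSpan_apply] at h5
  rw [h5, map_zero, AddMonoidHom.zero_apply]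

lemma bal_of_factor [IsNoetherianRing Cᵐᵒᵖ] (r : IeRel k C E) (M : Type) [AddCommGroup M]
    [Module Cᵐᵒᵖ M] [Module.Finite Cᵐᵒᵖ M]
    (h : ∀ g : r.P.P2 →ₗ[Cᵐᵒᵖ] M, ∃ f : r.P.P1 →ₗ[Cᵐᵒᵖ] M, g = f.comp r.P.d2) :
    IeBalZero C E M := by
  intro N _ β hβ m e
  have := r.P.p1
  obtain ⟨g, rfl⟩ := r.qs e
  obtain ⟨f, hf⟩ := h ((ieTo m).comp g)
  obtain ⟨n, mm, hmm⟩ := ie_gen (C := C) M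
  obtain ⟨F, hF⟩ := Module.projective_lifting_property _ f hmm
  let G : Fin n → (r.P.P2 →ₗ[Cᵐᵒᵖ] C) := fun i => -(((LinearMap.proj i).comp F).comp r.P.d2)
  have hG : ∀ i, r.q (G i) = 0 := fun i => by
    rw [map_neg, neg_eq_zero, r.q0]
    exact ⟨_, rfl⟩
  have := r.balA β hβ (n := n + 1) (Fin.cons m mm : Fin (n + 1) → M)
    (Fin.cons g G : Fin (n + 1) → (r.P.P2 →ₗ[Cᵐᵒᵖ] C)) (fun x => by
      rw [Fin.sum_univ_succ]
      simp only [Fin.cons_zero, Fin.cons_succ]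
      have h1 : op (g x) • m = f (r.P.d2 x) := LinearMap.congr_fun hf x
      have h2 : f (r.P.d2 x) = ∑ i, op (F (r.P.d2 x) i) • mm i := by
        rw [← ieSpan_apply, ← hF]; rfl
      rw [h1, h2, ← Finset.sum_add_distrib]
      refine Finset.sum_eq_zero fun i _ => ?_
      change _ + op (-(F (r.P.d2 x) i)) • mm i = 0
      rw [MulOpposite.op_neg, neg_smul, add_neg_cancel])
  rw [Fin.sum_univ_succ] at this
  simp only [Fin.cons_zero, Fin.cons_succ, hG, map_zero, Finset.sum_const_zero, add_zero] at this
  exact this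

lemma factor_of_bal (r : IeRel k C E) (M : Type) [AddCommGroup M]
    [Module Cᵐᵒᵖ M] [Module.Finite Cᵐᵒᵖ M] (h : IeBalZero C E M)
    (g : r.P.P2 →ₗ[Cᵐᵒᵖ] M) : ∃ f : r.P.P1 →ₗ[Cᵐᵒᵖ] M, g = f.comp r.P.d2 := by
  let S : AddSubgroup (r.P.P2 →ₗ[Cᵐᵒᵖ] M) :=
    (AddMonoidHom.mk' (fun f : r.P.P1 →ₗ[Cᵐᵒᵖ] M => f.comp r.P.d2)
      (fun a b => LinearMap.add_comp _ _ _)).range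
  let Φ : M → (r.P.P2 →ₗ[Cᵐᵒᵖ] C) → ((r.P.P2 →ₗ[Cᵐᵒᵖ] M) ⧸ S) := fun m g =>
    QuotientAddGroup.mk' S ((ieTo m).comp g)
  have hΦ1 : ∀ m g g', Φ m (g + g') = Φ m g + Φ m g' := fun m g g' => by
    change QuotientAddGroup.mk' S _ = _
    rw [LinearMap.comp_add, map_add]
  have hΦ2 : ∀ m m' g, Φ (m + m') g = Φ m g + Φ m' g := fun m m' g => by
    change QuotientAddGroup.mk' S _ = QuotientAddGroup.mk' S _ + QuotientAddGroup.mk' S _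
    rw [← map_add]
    congr 1
    ext x
    exact smul_add _ _ _
  have hΦ3 : ∀ m g g', r.q g = r.q g' → Φ m g = Φ m g' := fun m g g' hq => by
    rw [← sub_eq_zero, ← map_sub, r.q0] at hq
    obtain ⟨f, hf⟩ := hq
    have h1 : g = g' + f.comp r.P.d2 := by rw [← hf]; abel
    rw [h1, hΦ1]
    have h2 : Φ m (f.comp r.P.d2) = 0 :=
      (QuotientAddGroup.eq_zero_iff _).mpr ⟨(ieTo m).comp f, rfl⟩
    rw [h2, add_zero]
  choose s hs using r.qs
  let β : M →+ E →+ ((r.P.P2 →ₗ[Cᵐᵒᵖ] M) ⧸ S) :=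
    AddMonoidHom.mk' (fun m => AddMonoidHom.mk' (fun e => Φ m (s e)) (fun e e' => by
      rw [← hΦ1]
      apply hΦ3
      rw [map_add, hs, hs, hs]))
      (fun m m' => AddMonoidHom.ext fun e => hΦ2 m m' (s e))
  have hβ := h _ β (fun c m e => by
    change Φ (op c • m) (s e) = Φ m (s (c • e))
    have h1 : Φ (op c • m) (s e) = Φ m (c • s e) := by
      change QuotientAddGroup.mk' S _ = QuotientAddGroup.mk' S _
      congr 1
      ext x
      change op (s e x) • op c • m = op (c * s e x) • m
      rw [op_mul, mul_smul]
    rw [h1]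
    apply hΦ3
    rw [map_smul, hs, hs])
  have hΦ0 : ∀ m g, Φ m g = 0 := fun m g => by
    rw [← hβ m (r.q g)]
    exact hΦ3 _ _ _ (hs _).symm
  have := r.P.p2
  obtain ⟨n, mm, hmm⟩ := ie_gen (C := C) M
  obtain ⟨H, hH⟩ := Module.projective_lifting_property _ g hmm
  have h1 : g = ∑ i, (ieTo (mm i)).comp ((LinearMap.proj i).comp H) := by
    ext x
    rw [LinearMap.sum_apply, ← hH]
    exact ieSpan_apply mm (H x)
  have h2 : QuotientAddGroup.mk' S g = 0 := by
    rw [h1, map_sum]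
    exact Finset.sum_eq_zero fun i _ => hΦ0 _ _
  obtain ⟨f, hf⟩ := (QuotientAddGroup.eq_zero_iff _).mp h2
  exact ⟨f, hf.symm⟩

lemma id_iff_bal [FiniteDimensional k C] (hgl : GlDimLE2 Cᵐᵒᵖ) (r : IeRel k C E)
    (M : ModuleCat.{0} Cᵐᵒᵖ) [Module.Finite Cᵐᵒᵖ M] : IdLE1 Cᵐᵒᵖ M ↔ IeBalZero C E M := by
  have : Module.Finite k Cᵐᵒᵖ := Module.Finite.equiv (MulOpposite.opLinearEquiv k : C ≃ₗ[k] Cᵐᵒᵖ)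
  have : IsNoetherianRing Cᵐᵒᵖ := IsNoetherianRing.of_finite k Cᵐᵒᵖ
  constructor
  · intro h
    refine r.bal_of_factor M fun g => (r.P.κ_eq_zero M g).mp (ie_idle1_ext _ _ h _)
  · intro h
    refine ie_idle1 hgl r.DC M (fun J => r.dual.cogen _) (fun x => ?_)
    obtain ⟨g, rfl⟩ := r.P.κ_surj M x
    exact (r.P.κ_eq_zero M g).mpr (r.factor_of_bal M h g)

lemma pd_iff_hom [FiniteDimensional k C] [Module k E] [IsScalarTower k Cᵐᵒᵖ E]
    (hgl : GlDimLE2 Cᵐᵒᵖ) (r : IeRel k C E)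
    (M : ModuleCat.{0} Cᵐᵒᵖ) [Module.Finite Cᵐᵒᵖ M] :
    PdLE1 Cᵐᵒᵖ M ↔ ∀ f : E →ₗ[Cᵐᵒᵖ] M, f = 0 := by
  have : Module.Finite k Cᵐᵒᵖ := Module.Finite.equiv (MulOpposite.opLinearEquiv k : C ≃ₗ[k] Cᵐᵒᵖ)
  have : IsNoetherianRing Cᵐᵒᵖ := IsNoetherianRing.of_finite k Cᵐᵒᵖ
  rw [← r.ext_iff_hom_zero hgl M]
  constructor
  · intro h x
    exact ie_pdle1_ext _ _ h x
  · intro h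
    refine ie_pdle1 hgl M fun x => ?_
    let u : ModuleCat.of Cᵐᵒᵖ Cᵐᵒᵖ →ₗ[Cᵐᵒᵖ] ieA C := (MulOpposite.opLinearEquiv Cᵐᵒᵖ).symm.toLinearMap
    let v : ieA C →ₗ[Cᵐᵒᵖ] ModuleCat.of Cᵐᵒᵖ Cᵐᵒᵖ := (MulOpposite.opLinearEquiv Cᵐᵒᵖ).toLinearMap
    have huv : v.comp u = LinearMap.id := rfl
    have h1 : x.comp (Ext.mk₀ (ieh (v.comp u))) (add_zero 2) = x := by
      rw [huv]; exact Ext.comp_mk₀_id x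
    rw [← ieh_comp, ← Ext.mk₀_comp_mk₀, ← Ext.comp_assoc_of_third_deg_zero,
      h (x.comp (Ext.mk₀ (ieh u)) (add_zero 2)), Ext.zero_comp] at h1
    exact h1.symm

end IeRel
end BalPart

section TrivPart

variable {C : Type} [Ring C] {E : Type} [AddCommGroup E]
  [Module C E] [Module Cᵐᵒᵖ E] [SMulCommClass C Cᵐᵒᵖ E]

/-- identity map to `modB` -/
def ieToB (E : Type) [AddCommGroup E] [Module C E] [Module Cᵐᵒᵖ E] [SMulCommClass C Cᵐᵒᵖ E]
    (M : ModuleCat.{0} Cᵐᵒᵖ) : M ≃+ modB C E M := AddEquiv.refl M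

lemma ieToB_smul (M : ModuleCat.{0} Cᵐᵒᵖ) (b : TrivSqZeroExt C E) (m : M) :
    op b • ieToB E M m = ieToB E M (op b.fst • m) := rfl

lemma ie_inr_inl (e : E) (c : C) :
    (TrivSqZeroExt.inr e : TrivSqZeroExt C E) * tszeInl C E c = TrivSqZeroExt.inr (op c • e) :=
  TrivSqZeroExt.inr_mul_inl (R := C) (M := E) c e

lemma ie_inl_inr (e : E) (c : C) :
    tszeInl C E c * (TrivSqZeroExt.inr e : TrivSqZeroExt C E) = TrivSqZeroExt.inr (c • e) :=
  TrivSqZeroExt.inl_mul_inr (R := C) (M := E) c e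

lemma ie_decomp (b : TrivSqZeroExt C E) : b = tszeInl C E b.fst + TrivSqZeroExt.inr b.snd :=
  (TrivSqZeroExt.inl_fst_add_inr_snd_eq b).symm

lemma ie_kill {M : ModuleCat.{0} Cᵐᵒᵖ} {X : ModuleCat.{0} (TrivSqZeroExt C E)ᵐᵒᵖ}
    (u : X ≃ₗ[(TrivSqZeroExt C E)ᵐᵒᵖ] modB C E M) (e : E) (x : X) :
    op (TrivSqZeroExt.inr e : TrivSqZeroExt C E) • x = 0 := by
  apply u.injective
  rw [map_smul, map_zero]
  change op (0 : C) • (ieToB E M).symm (u x) = 0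
  rw [MulOpposite.op_zero, zero_smul]

/-! ### the induced module -/

lemma ie_ind_exists (M : ModuleCat.{0} Cᵐᵒᵖ) : ∃ X, IsInduced C E M X := by
  let B := TrivSqZeroExt C E
  let S : Submodule Bᵐᵒᵖ (M →₀ Bᵐᵒᵖ) := Submodule.span Bᵐᵒᵖ
    ({z | ∃ m m' : M, z = Finsupp.single (m + m') 1 - (Finsupp.single m 1 + Finsupp.single m' 1)} ∪
     {z | ∃ (c : C) (m : M), z = Finsupp.single (op c • m) 1 -
        op (tszeInl C E c) • Finsupp.single m 1})
  let φ : M →+ ((M →₀ Bᵐᵒᵖ) ⧸ S) := AddMonoidHom.mk' (fun m => S.mkQ (Finsupp.single m 1))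
    (fun m m' => by
      rw [← map_add, ← sub_eq_zero, ← map_sub]
      exact (Submodule.Quotient.mk_eq_zero S).mpr (Submodule.subset_span (Or.inl ⟨m, m', rfl⟩)))
  refine ⟨ModuleCat.of Bᵐᵒᵖ ((M →₀ Bᵐᵒᵖ) ⧸ S), φ, ?_, ?_⟩
  · intro c m
    change S.mkQ _ = op (tszeInl C E c) • S.mkQ _
    rw [← map_smul, ← sub_eq_zero, ← map_sub]
    exact (Submodule.Quotient.mk_eq_zero S).mpr (Submodule.subset_span (Or.inr ⟨c, m, rfl⟩))
  · intro Y ψ hψ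
    let l : (M →₀ Bᵐᵒᵖ) →ₗ[Bᵐᵒᵖ] Y := Finsupp.linearCombination Bᵐᵒᵖ (fun m => ψ m)
    have hl : ∀ m, l (Finsupp.single m 1) = ψ m := fun m => by
      change Finsupp.linearCombination Bᵐᵒᵖ (fun m => ψ m) _ = _
      rw [Finsupp.linearCombination_single, one_smul]
    have hS : S ≤ LinearMap.ker l := by
      rw [Submodule.span_le]
      rintro z (⟨m, m', rfl⟩ | ⟨c, m, rfl⟩)
      · change l _ = 0
        rw [map_sub, map_add, hl, hl, hl, map_add, sub_self]
      · change l _ = 0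
        rw [map_sub, map_smul, hl, hl, hψ, sub_self]
    refine ⟨S.liftQ l hS, fun m => hl m, ?_⟩
    intro h hh
    refine Submodule.linearMap_qext S (Finsupp.lhom_ext' fun m => LinearMap.ext_ring ?_)
    exact (hh m).trans (hl m).symm

/-- the test module for balanced maps -/
abbrev ieYmod {M : Type} [AddCommGroup M] [Module Cᵐᵒᵖ M] {N : Type} [AddCommGroup N]
    (β : M →+ E →+ N) (hβ : ∀ (c : C) m e, β (op c • m) e = β m (c • e)) :
    Module (TrivSqZeroExt C E)ᵐᵒᵖ (M × (C →+ N)) where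
  smul b y := (op (unop b).fst • y.1, AddMonoidHom.mk'
    (fun x => y.2 ((unop b).fst * x) + β y.1 (op x • (unop b).snd)) (fun x x' => by
      rw [mul_add, map_add, MulOpposite.op_add, add_smul, map_add]; abel))
  one_smul y := Prod.ext (one_smul _ _) (AddMonoidHom.ext fun x => by
    change y.2 (1 * x) + β y.1 (op x • (0 : E)) = y.2 x
    rw [one_mul, smul_zero, map_zero, add_zero])
  mul_smul b b' y := Prod.ext (mul_smul (op (unop b).fst) (op (unop b').fst) y.1)
    (AddMonoidHom.ext fun x => by
      change y.2 (((unop b').fst * (unop b).fst) * x) +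
        β y.1 (op x • ((unop b').fst • (unop b).snd + op (unop b).fst • (unop b').snd)) =
        (y.2 ((unop b').fst * ((unop b).fst * x)) +
          β y.1 (op ((unop b).fst * x) • (unop b').snd)) +
        β (op (unop b').fst • y.1) (op x • (unop b).snd)
      rw [hβ, smul_add, map_add, mul_assoc, op_mul, mul_smul,
        ← smul_comm (unop b').fst (op x) (unop b).snd]
      abel)
  smul_zero b := Prod.ext (smul_zero _) (AddMonoidHom.ext fun x => by
    change (0 : C →+ N) _ + β 0 _ = 0
    rw [map_zero]; simp)
  zero_smul y := Prod.ext (zero_smul Cᵐᵒᵖ y.1) (AddMonoidHom.ext fun x => by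
    change y.2 (0 * x) + β y.1 (op x • (0 : E)) = 0
    rw [zero_mul, smul_zero, map_zero, map_zero, add_zero])
  smul_add b y y' := Prod.ext (smul_add _ _ _) (AddMonoidHom.ext fun x => by
    change (y.2 + y'.2) _ + β (y.1 + y'.1) _ = (y.2 _ + β y.1 _) + (y'.2 _ + β y'.1 _)
    rw [map_add, AddMonoidHom.add_apply, AddMonoidHom.add_apply]; abel)
  add_smul b b' y := Prod.ext (add_smul (op (unop b).fst) (op (unop b').fst) y.1)
    (AddMonoidHom.ext fun x => by
      change y.2 (((unop b).fst + (unop b').fst) * x) +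
        β y.1 (op x • ((unop b).snd + (unop b').snd)) =
        (y.2 ((unop b).fst * x) + β y.1 (op x • (unop b).snd)) +
        (y.2 ((unop b').fst * x) + β y.1 (op x • (unop b').snd))
      rw [add_mul, smul_add, map_add, map_add]; abel)

lemma ie_bal_iff (M : ModuleCat.{0} Cᵐᵒᵖ) : IeBalZero C E M ↔ ∀ X, IsInduced C E M X →
    Nonempty (X ≃ₗ[(TrivSqZeroExt C E)ᵐᵒᵖ] modB C E M) := by
  constructor
  · rintro hb X ⟨φ, hφ, hu⟩
    have h0 : ∀ (m : M) (e : E), op (TrivSqZeroExt.inr e : TrivSqZeroExt C E) • φ m = 0 :=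
      hb X (AddMonoidHom.mk' (fun m => AddMonoidHom.mk'
        (fun e => op (TrivSqZeroExt.inr e : TrivSqZeroExt C E) • φ m)
        (fun e e' => by rw [TrivSqZeroExt.inr_add, MulOpposite.op_add, add_smul]))
        (fun m m' => AddMonoidHom.ext fun e => by
          change op (TrivSqZeroExt.inr e : TrivSqZeroExt C E) • φ (m + m') = _
          rw [map_add, smul_add]; rfl)) (fun c m e => by
          change op (TrivSqZeroExt.inr e : TrivSqZeroExt C E) • φ (op c • m) =
            op (TrivSqZeroExt.inr (c • e) : TrivSqZeroExt C E) • φ m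
          rw [hφ, ← mul_smul, ← op_mul, ie_inl_inr])
    let g : modB C E M →ₗ[(TrivSqZeroExt C E)ᵐᵒᵖ] X :=
      { toFun := fun m => φ ((ieToB E M).symm m)
        map_add' := fun m m' => by rw [map_add, map_add]
        map_smul' := fun b m => by
          induction b using MulOpposite.rec' with | _ b =>
          change φ (op b.fst • (ieToB E M).symm m) = op b • φ ((ieToB E M).symm m)
          conv_rhs => rw [ie_decomp b]
          rw [MulOpposite.op_add, add_smul, h0, add_zero, hφ] }
    obtain ⟨h, hh, -⟩ := hu (modB C E M) (ieToB E M).toAddMonoidHom (fun c m => rfl)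
    have hh' : ∀ m, h (φ m) = ieToB E M m := hh
    refine ⟨LinearEquiv.ofLinearMap h g ?_ ?_⟩
    · ext1 m
      exact hh' ((ieToB E M).symm m)
    · refine (hu X φ hφ).unique (fun m => ?_) (fun m => rfl)
      change g (h (φ m)) = φ m
      rw [hh']; rfl
  · intro H N _ β hβ m e
    obtain ⟨X, hX⟩ := ie_ind_exists (E := E) M
    obtain ⟨u⟩ := H X hX
    obtain ⟨φ, hφ, hu⟩ := hX
    let mod := ieYmod β hβ
    obtain ⟨h, hh, -⟩ := hu (@ModuleCat.of _ _ (M × (C →+ N)) _ mod) (AddMonoidHom.inl M (C →+ N))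
      (fun c m => Prod.ext rfl (AddMonoidHom.ext fun x => by
        change (0 : N) = 0 + β m (op x • (0 : E))
        rw [smul_zero, map_zero, add_zero]))
    have h1 := ie_kill u e (φ m)
    have h2 := congrArg h h1
    rw [map_smul, hh, map_zero] at h2
    have h3 : (0 : N) + β m (op (1 : C) • e) = 0 :=
      congrArg (fun y : M × (C →+ N) => y.2 1) h2
    rwa [zero_add, op_one, one_smul] at h3

/-! ### the coinduced module -/

/-- `Hom_C(B, M)` as an additive group -/
def ieCo (C : Type) [Ring C] (E : Type) [AddCommGroup E]
    [Module C E] [Module Cᵐᵒᵖ E] [SMulCommClass C Cᵐᵒᵖ E] (M : ModuleCat.{0} Cᵐᵒᵖ) :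
    AddSubgroup (TrivSqZeroExt C E →+ M) where
  carrier := {F | ∀ b c, F (b * tszeInl C E c) = op c • F b}
  zero_mem' := fun b c => (smul_zero _).symm
  add_mem' := fun {F G} hF hG b c => by
    rw [AddMonoidHom.add_apply, hF, hG, ← smul_add]; rfl
  neg_mem' := fun {F} hF b c => by
    rw [AddMonoidHom.neg_apply, hF, ← smul_neg]; rfl

/-- the right `B`-module structure -/
abbrev ieCoMod (M : ModuleCat.{0} Cᵐᵒᵖ) : Module (TrivSqZeroExt C E)ᵐᵒᵖ (ieCo C E M) where
  smul b F := ⟨F.1.comp (AddMonoidHom.mulLeft (unop b)), fun x c => by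
    change F.1 (unop b * (x * tszeInl C E c)) = op c • F.1 (unop b * x)
    rw [← mul_assoc, F.2]⟩
  one_smul F := Subtype.ext (AddMonoidHom.ext fun x => congrArg F.1 (one_mul x))
  mul_smul b b' F := Subtype.ext (AddMonoidHom.ext fun x =>
    congrArg F.1 (mul_assoc (unop b') (unop b) x))
  smul_zero b := rfl
  zero_smul F := Subtype.ext (AddMonoidHom.ext fun x =>
    (congrArg F.1 (zero_mul x)).trans (map_zero F.1))
  smul_add b F G := rfl
  add_smul b b' F := Subtype.ext (AddMonoidHom.ext fun x =>
    (congrArg F.1 (add_mul (unop b) (unop b') x)).trans (map_add F.1 _ _))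

lemma ie_co_exists (M : ModuleCat.{0} Cᵐᵒᵖ) : ∃ X, IsCoinduced C E M X := by
  let mod := ieCoMod (E := E) M
  let X := ModuleCat.of (TrivSqZeroExt C E)ᵐᵒᵖ (ieCo C E M)
  let p : X →+ M := AddMonoidHom.mk' (fun F : ieCo C E M => F.1 1) (fun F G => rfl)
  have hp : ∀ (b : TrivSqZeroExt C E) (F : ieCo C E M), p (op b • F) = F.1 b := fun b F =>
    congrArg F.1 (mul_one b)
  refine ⟨X, p, ?_, ?_⟩
  · intro c F
    refine (hp _ _).trans ?_
    have := F.2 1 c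
    rwa [one_mul] at this
  · intro Y ψ hψ
    let h : Y →ₗ[(TrivSqZeroExt C E)ᵐᵒᵖ] X :=
      { toFun := fun y => (⟨AddMonoidHom.mk' (fun b => ψ (op b • y)) (fun b b' => by
            rw [MulOpposite.op_add, add_smul, map_add]), fun b c => by
            change ψ (op (b * tszeInl C E c) • y) = op c • ψ (op b • y)
            rw [op_mul, mul_smul, hψ]⟩ : ieCo C E M)
        map_add' := fun y y' => Subtype.ext (AddMonoidHom.ext fun b => by
          change ψ (op b • (y + y')) = ψ (op b • y) + ψ (op b • y')
          rw [smul_add, map_add])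
        map_smul' := fun a y => Subtype.ext (AddMonoidHom.ext fun b => by
          change ψ (op b • a • y) = ψ (op (unop a * b) • y)
          rw [op_mul, op_unop, mul_smul]) }
    refine ⟨h, fun y => ?_, fun h' hh' => ?_⟩
    · change ψ (op 1 • y) = ψ y
      rw [op_one, one_smul]
    · refine LinearMap.ext fun y => Subtype.ext (AddMonoidHom.ext fun b => ?_)
      change (h' y : ieCo C E M).1 b = ψ (op b • y)
      rw [← hh', map_smul]
      exact (hp b (h' y)).symm

lemma ie_hom_iff (M : ModuleCat.{0} Cᵐᵒᵖ) : (∀ f : E →ₗ[Cᵐᵒᵖ] M, f = 0) ↔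
    ∀ X, IsCoinduced C E M X →
      Nonempty (X ≃ₗ[(TrivSqZeroExt C E)ᵐᵒᵖ] modB C E M) := by
  constructor
  · rintro hf X ⟨p, hp, hu⟩
    have h0 : ∀ (x : X) (e : E), p (op (TrivSqZeroExt.inr e : TrivSqZeroExt C E) • x) = 0 := by
      intro x e
      let f : E →ₗ[Cᵐᵒᵖ] M :=
        { toFun := fun e => p (op (TrivSqZeroExt.inr e : TrivSqZeroExt C E) • x)
          map_add' := fun e e' => by
            rw [TrivSqZeroExt.inr_add, MulOpposite.op_add, add_smul, map_add]
          map_smul' := fun c e => by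
            induction c using MulOpposite.rec' with | _ c =>
            rw [RingHom.id_apply, ← ie_inr_inl, op_mul, mul_smul, hp] }
      exact LinearMap.congr_fun (hf f) e
    let g : X →ₗ[(TrivSqZeroExt C E)ᵐᵒᵖ] modB C E M :=
      { toFun := fun x => ieToB E M (p x)
        map_add' := fun x y => by rw [map_add, map_add]
        map_smul' := fun b x => by
          induction b using MulOpposite.rec' with | _ b =>
          rw [RingHom.id_apply, ieToB_smul]
          congr 1
          conv_lhs => rw [ie_decomp b]
          rw [MulOpposite.op_add, add_smul, map_add, h0, add_zero, hp] }
    obtain ⟨h, hh, -⟩ := hu (modB C E M) (ieToB E M).symm.toAddMonoidHom (fun c m => rfl)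
    have hh' : ∀ m, p (h m) = (ieToB E M).symm m := hh
    refine ⟨LinearEquiv.ofLinearMap g h ?_ ?_⟩
    · ext1 m
      exact hh' m
    · refine (hu X p hp).unique (fun x => ?_) (fun x => rfl)
      change p (h (g x)) = p x
      rw [hh']; rfl
  · intro H f
    obtain ⟨X, hX⟩ := ie_co_exists (E := E) M
    obtain ⟨u⟩ := H X hX
    obtain ⟨p, hp, hu⟩ := hX
    obtain ⟨h, hh, -⟩ := hu (ModuleCat.of (TrivSqZeroExt C E)ᵐᵒᵖ (TrivSqZeroExt C E))
      (AddMonoidHom.mk' (fun b : TrivSqZeroExt C E => f b.snd) (fun b b' => map_add f _ _))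
      (fun c b => by
        change f ((b : TrivSqZeroExt C E).fst • (0 : E) + op c • (b : TrivSqZeroExt C E).snd) = _
        rw [smul_zero, zero_add, map_smul]; rfl)
    ext1 e
    have h1 := hh (TrivSqZeroExt.inr e : TrivSqZeroExt C E)
    have h2 : h (TrivSqZeroExt.inr e : TrivSqZeroExt C E) = 0 := by
      have h3 : (TrivSqZeroExt.inr e : TrivSqZeroExt C E) =
        op (TrivSqZeroExt.inr e : TrivSqZeroExt C E) • (1 : TrivSqZeroExt C E) := (one_mul _).symm
      refine Eq.trans (congrArg h h3) ?_
      refine Eq.trans (map_smul h _ _) ?_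
      exact ie_kill u e _
    rw [h2, map_zero] at h1
    exact h1.symm

end TrivPart

/-- For `C` of global dimension at most 2 and `B = C ⋉ Ext²(DC, C)`:
`id_C M ≤ 1` iff `M ⊗_C B ≅ M`, and `pd_C M ≤ 1` iff `D(B ⊗_C DM) ≅ M`. -/
theorem induced_coinduced_iso_iff
    (k : Type) [Field k] (C : Type) [Ring C] [Algebra k C] [FiniteDimensional k C]
    (E : Type) [AddCommGroup E] [Module C E] [Module Cᵐᵒᵖ E] [SMulCommClass C Cᵐᵒᵖ E]
    [Module k E] [IsScalarTower k C E] [IsScalarTower k Cᵐᵒᵖ E]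
    (hgl : GlDimLE2 Cᵐᵒᵖ) (hE : IsRelExt k C E)
    (M : Mdl Cᵐᵒᵖ) [Module.Finite Cᵐᵒᵖ M] :
    (IdLE1 Cᵐᵒᵖ M ↔ ∀ X, IsInduced C E M X →
        Nonempty (X ≃ₗ[(TrivSqZeroExt C E)ᵐᵒᵖ] modB C E M)) ∧
    (PdLE1 Cᵐᵒᵖ M ↔ ∀ X, IsCoinduced C E M X →
        Nonempty (X ≃ₗ[(TrivSqZeroExt C E)ᵐᵒᵖ] modB C E M)) := by
  obtain ⟨r⟩ := ie_rel hE
  exact ⟨(r.id_iff_bal hgl M).trans (ie_bal_iff M), (r.pd_iff_hom hgl M).trans (ie_hom_iff M)⟩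
end

section
/- Let C be an algebra of global dimension 2 and B = C ⋉ Ext^2_C(DC,C). If M is a τ_C-rigid C-module with pd_C τ_C M ≤ 1, then the induced module M ⊗_C B is τ_B-rigid. -/
open CategoryTheory MulOpposite

open CategoryTheory MulOpposite

section Homological

theorem ker_pd_iff {R : Type} [Ring R] {P M : Type} [AddCommGroup P] [Module R P]
    [AddCommGroup M] [Module R M] [Module.Projective R P] (f : P →ₗ[R] M)
    (hf : Function.Surjective f) (n : ℕ) :
    HasProjectiveDimensionLT (ModuleCat.of R M) (n + 2) ↔
      HasProjectiveDimensionLT (ModuleCat.of R (LinearMap.ker f)) (n + 1) :=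
  (LinearMap.shortExact_shortComplexKer hf).hasProjectiveDimensionLT_X₃_iff n
    (inferInstanceAs (Projective (ModuleCat.of R P)))

theorem proj_pd_one {R : Type} [Ring R] {P : Type} [AddCommGroup P] [Module R P] :
    Module.Projective R P ↔ HasProjectiveDimensionLT (ModuleCat.of R P) 1 := by
  rw [← projective_iff_hasProjectiveDimensionLT_one, ← IsProjective.iff_projective]

theorem pd_congr {R : Type} [Ring R] {P Q : Type} [AddCommGroup P] [Module R P]
    [AddCommGroup Q] [Module R Q] (e : P ≃ₗ[R] Q) (n : ℕ)
    (h : HasProjectiveDimensionLT (ModuleCat.of R P) n) :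
    HasProjectiveDimensionLT (ModuleCat.of R Q) n :=
  hasProjectiveDimensionLT_of_iso e.toModuleIso n

/-- If `P1 → P0 → M → 0` is exact with `P0` projective then `pd M ≤ n+1` iff
the image of `P1` has `pd ≤ n`. -/
theorem pd_range_iff {R : Type} [Ring R] {P1 P M : Type} [AddCommGroup P] [Module R P]
    [AddCommGroup P1] [Module R P1]
    [AddCommGroup M] [Module R M] [Module.Projective R P] (d : P1 →ₗ[R] P) (f : P →ₗ[R] M)
    (hf : Function.Surjective f) (hd : LinearMap.range d = LinearMap.ker f) (n : ℕ) :
    HasProjectiveDimensionLT (ModuleCat.of R M) (n + 2) ↔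
      HasProjectiveDimensionLT (ModuleCat.of R (LinearMap.range d)) (n + 1) := by
  rw [ker_pd_iff f hf n]
  exact ⟨pd_congr (LinearEquiv.ofEq _ _ hd.symm) _, pd_congr (LinearEquiv.ofEq _ _ hd) _⟩

theorem PdLE1.lt {R : Type} [Ring R] {M : Mdl R} (h : PdLE1 R M) :
    HasProjectiveDimensionLT (ModuleCat.of R M) 2 := by
  obtain ⟨P1, P0, d1, d0, h1, h0, i1, s0, e⟩ := h
  rw [pd_range_iff d1 d0 s0 e 0]
  exact pd_congr (LinearEquiv.ofInjective d1 i1) _ (proj_pd_one.1 h1)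

theorem PdLE2.lt {R : Type} [Ring R] {M : Mdl R} (h : PdLE2 R M) :
    HasProjectiveDimensionLT (ModuleCat.of R M) 3 := by
  obtain ⟨P2, P1, P0, d2, d1, d0, h2, h1, h0, i2, s0, e1, e0⟩ := h
  rw [pd_range_iff d1 d0 s0 e0 1,
    pd_range_iff d2 d1.rangeRestrict d1.surjective_rangeRestrict
      (by rw [LinearMap.ker_rangeRestrict, e1]) 0]
  exact pd_congr (LinearEquiv.ofInjective d2 i2) _ (proj_pd_one.1 h2)

/-- The mapping cone argument: the last differential of the cone splits. -/
theorem cone_split {R : Type} [Ring R] (hgl : GlDimLE2 R)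
    {P2 P1 P0 D Q2 Q1 Q0 D' : Type}
    [AddCommGroup P2] [Module R P2] [AddCommGroup P1] [Module R P1]
    [AddCommGroup P0] [Module R P0] [AddCommGroup D] [Module R D]
    [AddCommGroup Q2] [Module R Q2] [AddCommGroup Q1] [Module R Q1]
    [AddCommGroup Q0] [Module R Q0] [AddCommGroup D'] [Module R D']
    [Module.Projective R P1] [Module.Projective R P0]
    [Module.Projective R Q2] [Module.Projective R Q1] [Module.Projective R Q0]
    (d2 : P2 →ₗ[R] P1) (d1 : P1 →ₗ[R] P0) (d0 : P0 →ₗ[R] D)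
    (i2 : Function.Injective d2) (s0 : Function.Surjective d0)
    (e1 : LinearMap.range d2 = LinearMap.ker d1) (e0 : LinearMap.range d1 = LinearMap.ker d0)
    (d2' : Q2 →ₗ[R] Q1) (d1' : Q1 →ₗ[R] Q0) (d0' : Q0 →ₗ[R] D')
    (i2' : Function.Injective d2') (s0' : Function.Surjective d0')
    (e1' : LinearMap.range d2' = LinearMap.ker d1')
    (e0' : LinearMap.range d1' = LinearMap.ker d0')
    (F2 : P2 →ₗ[R] Q2) (F1 : P1 →ₗ[R] Q1) (F0 : P0 →ₗ[R] Q0) (α : D →ₗ[R] D')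
    (c0 : ∀ x, d0' (F0 x) = α (d0 x)) (c1 : ∀ x, d1' (F1 x) = F0 (d1 x))
    (c2 : ∀ x, d2' (F2 x) = F1 (d2 x))
    (hN : HasProjectiveDimensionLT (ModuleCat.of R (LinearMap.ker α)) 2) :
    ∃ ρ : (P1 × Q2) →ₗ[R] P2, ∀ x, ρ (d2 x, F2 x) = x := by
  have E1 : ∀ x, d1 x = 0 → ∃ y, d2 y = x := fun x hx => by
    have : x ∈ LinearMap.range d2 := e1 ▸ hx
    simpa using this
  have E0 : ∀ x, d0 x = 0 → ∃ y, d1 y = x := fun x hx => by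
    have : x ∈ LinearMap.range d1 := e0 ▸ hx
    simpa using this
  have E1' : ∀ x, d1' x = 0 → ∃ y, d2' y = x := fun x hx => by
    have : x ∈ LinearMap.range d2' := e1' ▸ hx
    simpa using this
  have E0' : ∀ x, d0' x = 0 → ∃ y, d1' y = x := fun x hx => by
    have : x ∈ LinearMap.range d1' := e0' ▸ hx
    simpa using this
  have Z1 : ∀ x, d1 (d2 x) = 0 := fun x => by
    have : d2 x ∈ LinearMap.ker d1 := e1 ▸ LinearMap.mem_range_self d2 x
    simpa using this
  have Z0 : ∀ x, d0 (d1 x) = 0 := fun x => by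
    have : d1 x ∈ LinearMap.ker d0 := e0 ▸ LinearMap.mem_range_self d1 x
    simpa using this
  have Z1' : ∀ x, d1' (d2' x) = 0 := fun x => by
    have : d2' x ∈ LinearMap.ker d1' := e1' ▸ LinearMap.mem_range_self d2' x
    simpa using this
  have Z0' : ∀ x, d0' (d1' x) = 0 := fun x => by
    have : d1' x ∈ LinearMap.ker d0' := e0' ▸ LinearMap.mem_range_self d1' x
    simpa using this
  let D3 : P2 →ₗ[R] P1 × Q2 := d2.prod F2
  let D1 : P0 × Q1 →ₗ[R] Q0 := F0.coprod d1'
  let D2 : P1 × Q2 →ₗ[R] P0 × Q1 :=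
    (d1.comp (LinearMap.fst R P1 Q2)).prod
      (d2'.comp (LinearMap.snd R P1 Q2) - F1.comp (LinearMap.fst R P1 Q2))
  have D1a : ∀ x y, D1 (x, y) = F0 x + d1' y := fun x y => by simp [D1]
  have D2a : ∀ x y, D2 (x, y) = (d1 x, d2' y - F1 x) := fun x y => by simp [D2]
  have D3a : ∀ x, D3 x = (d2 x, F2 x) := fun x => by simp [D3]
  -- the kernel of `D1` is projective
  let Q := D' ⧸ LinearMap.range α
  let π : Q0 →ₗ[R] Q := (LinearMap.range α).mkQ.comp d0'
  have hπ : Function.Surjective π := (Submodule.mkQ_surjective _).comp s0'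
  have hD1 : LinearMap.range D1 = LinearMap.ker π := by
    ext p
    have hmem : p ∈ LinearMap.ker π ↔ d0' p ∈ LinearMap.range α := by
      rw [LinearMap.mem_ker]; exact Submodule.Quotient.mk_eq_zero _
    rw [hmem]
    constructor
    · rintro ⟨⟨x, y⟩, rfl⟩
      exact ⟨d0 x, by rw [D1a, map_add, c0, Z0', add_zero]⟩
    · rintro ⟨n, hn⟩
      obtain ⟨x, rfl⟩ := s0 n
      obtain ⟨y, hy⟩ := E0' (p - F0 x) (by rw [map_sub, c0, hn, sub_self])
      exact ⟨(x, y), by rw [D1a, hy]; abel⟩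
  have hZ : Module.Projective R (LinearMap.ker D1) := by
    have h3 := (hgl (ModuleCat.of R Q)).lt
    rw [proj_pd_one]
    have h2 := (pd_range_iff D1 π hπ hD1 1).1 h3
    have h1 := (ker_pd_iff D1.rangeRestrict D1.surjective_rangeRestrict 0).1 h2
    exact pd_congr (LinearEquiv.ofEq _ _ (LinearMap.ker_rangeRestrict _)) _ h1
  have D12 : ∀ v, D1 (D2 v) = 0 := by
    rintro ⟨x, y⟩
    rw [D2a, D1a, map_sub, Z1', c1]; abel
  let D2' : P1 × Q2 →ₗ[R] LinearMap.ker D1 := D2.codRestrict _ D12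
  let ψ : LinearMap.ker D1 →ₗ[R] LinearMap.ker α :=
    ((d0.comp (LinearMap.fst R P0 Q1)).comp (LinearMap.ker D1).subtype).codRestrict _ (by
      rintro ⟨⟨x, y⟩, h⟩
      rw [LinearMap.mem_ker, D1a] at h
      simp only [LinearMap.comp_apply, Submodule.subtype_apply, LinearMap.fst_apply,
        LinearMap.mem_ker]
      have := congrArg d0' h
      rwa [map_add, Z0', add_zero, c0, map_zero] at this)
  have hψa : ∀ (x y h), ((ψ ⟨(x, y), h⟩ : LinearMap.ker α) : D) = d0 x := fun x y h => rfl
  have hψ : Function.Surjective ψ := by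
    rintro ⟨n, hn⟩
    obtain ⟨x, rfl⟩ := s0 n
    obtain ⟨y, hy⟩ := E0' (F0 x) (by rw [c0]; exact hn)
    refine ⟨⟨(x, -y), ?_⟩, Subtype.ext ?_⟩
    · rw [LinearMap.mem_ker, D1a, map_neg, hy, add_neg_cancel]
    · rw [hψa]
  have hr : LinearMap.range D2' = LinearMap.ker ψ := by
    ext ⟨⟨x, y⟩, h⟩
    rw [LinearMap.mem_ker, D1a] at h
    constructor
    · rintro ⟨⟨x1, y2⟩, h1⟩
      have h2 := congrArg Subtype.val h1
      change D2 (x1, y2) = (x, y) at h2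
      rw [D2a] at h2
      rw [LinearMap.mem_ker]
      apply Subtype.ext
      have h3 : d1 x1 = x := congrArg Prod.fst h2
      rw [hψa, ← h3]
      exact Z0 _
    · intro h1
      have h2 := congrArg Subtype.val (LinearMap.mem_ker.1 h1)
      rw [hψa] at h2
      obtain ⟨x1, rfl⟩ := E0 x h2
      obtain ⟨y2, hy⟩ := E1' (F1 x1 + y) (by rw [map_add, c1, h])
      refine ⟨(x1, y2), Subtype.ext ?_⟩
      change D2 (x1, y2) = _
      rw [D2a, hy, add_sub_cancel_left]
  have hB : Module.Projective R (LinearMap.range D2') := by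
    exact (proj_pd_one (R := R) (P := LinearMap.range D2')).2 ((pd_range_iff D2' ψ hψ hr 0).1 hN)
  obtain ⟨t, ht⟩ := Module.projective_lifting_property D2'.rangeRestrict LinearMap.id
    D2'.surjective_rangeRestrict
  -- split
  have hker : ∀ v, D2 v = 0 → ∃ z, D3 z = v := by
    rintro ⟨x, y⟩ h
    rw [D2a, Prod.mk_eq_zero] at h
    obtain ⟨z, rfl⟩ := E1 x h.1
    refine ⟨z, ?_⟩
    rw [D3a]
    congr 1
    apply i2'
    rw [c2]
    exact (sub_eq_zero.1 h.2).symm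
  have hinj : Function.Injective D3 := fun a b h => i2 (by
    rw [D3a, D3a] at h; exact congrArg Prod.fst h)
  let s : P1 × Q2 →ₗ[R] P1 × Q2 := LinearMap.id - t.comp D2'.rangeRestrict
  have hs : ∀ v, s v ∈ LinearMap.range D3 := by
    intro v
    apply hker
    have := LinearMap.congr_fun ht (D2'.rangeRestrict v)
    have h2 := congrArg (fun z : LinearMap.range D2' => ((z : LinearMap.ker D1) : P0 × Q1)) this
    simp only [LinearMap.comp_apply, LinearMap.id_apply] at h2
    change D2 _ = D2 v at h2
    simp only [s, LinearMap.sub_apply, LinearMap.id_apply, LinearMap.comp_apply, map_sub]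
    rw [h2, sub_self]
  let e := LinearEquiv.ofInjective D3 hinj
  refine ⟨e.symm.toLinearMap.comp (s.codRestrict _ hs), fun x => ?_⟩
  rw [← D3a]
  change e.symm _ = x
  rw [LinearEquiv.symm_apply_eq]
  apply Subtype.ext
  change s (D3 x) = D3 x
  have : D2'.rangeRestrict (D3 x) = 0 := by
    apply Subtype.ext
    apply Subtype.ext
    change D2 (D3 x) = 0
    rw [D3a, D2a, Z1, c2, sub_self]; rfl
  simp only [s, LinearMap.sub_apply, LinearMap.id_apply, LinearMap.comp_apply]
  rw [this, map_zero, sub_zero]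

end Homological

section ExtVanish

theorem projective_pi {R : Type} [Ring R] {ι P : Type} [Finite ι] [AddCommGroup P] [Module R P]
    [h : Module.Projective R P] : Module.Projective R (ι → P) := by
  classical
  cases nonempty_fintype ι
  exact Module.Projective.of_equiv (DFinsupp.linearEquivFunOnFintype (R := R) (M := fun _ : ι => P))

theorem range_compLeft {R : Type} [Ring R] {ι P Q S : Type}
    [AddCommGroup P] [Module R P] [AddCommGroup Q] [Module R Q] [AddCommGroup S] [Module R S]
    (f : P →ₗ[R] Q) (g : Q →ₗ[R] S) (h : LinearMap.range f = LinearMap.ker g) :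
    LinearMap.range (f.compLeft ι) = LinearMap.ker (g.compLeft ι) := by
  ext x
  constructor
  · rintro ⟨y, rfl⟩
    rw [LinearMap.mem_ker]
    ext i
    have : f (y i) ∈ LinearMap.ker g := h ▸ LinearMap.mem_range_self f (y i)
    exact this
  · intro hx
    have : ∀ i, ∃ y, f y = x i := fun i => by
      have h1 : x i ∈ LinearMap.ker g := congrFun (LinearMap.mem_ker.1 hx) i
      rw [← h] at h1
      exact h1
    choose y hy using this
    exact ⟨y, funext hy⟩

/-- matrix of linear maps acting on column vectors -/
def matMap {R : Type} [Ring R] {ι σ P : Type} [Fintype ι] [AddCommGroup P] [Module R P]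
    (f : σ → ι → (P →ₗ[R] P)) : (ι → P) →ₗ[R] (σ → P) :=
  LinearMap.pi fun i => ∑ j, (f i j).comp (LinearMap.proj j)

theorem matMap_apply {R : Type} [Ring R] {ι σ P : Type} [Fintype ι] [AddCommGroup P] [Module R P]
    (f : σ → ι → (P →ₗ[R] P)) (x : ι → P) (i : σ) :
    matMap f x i = ∑ j, f i j (x j) := by
  simp [matMap]

theorem matMap_comm {R : Type} [Ring R] {ι σ P Q : Type} [Fintype ι]
    [AddCommGroup P] [Module R P] [AddCommGroup Q] [Module R Q]
    (f : σ → ι → (P →ₗ[R] P)) (g : σ → ι → (Q →ₗ[R] Q)) (d : P →ₗ[R] Q)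
    (h : ∀ i j, d.comp (f i j) = (g i j).comp d) (x : ι → P) :
    d.compLeft σ (matMap f x) = matMap g (d.compLeft ι x) := by
  ext i
  rw [matMap_apply]
  change d (matMap f x i) = _
  rw [matMap_apply, map_sum]
  exact Finset.sum_congr rfl fun j _ => LinearMap.congr_fun (h i j) (x j)

theorem hom_relExt_zero
    (k : Type) [Field k] (C : Type) [Ring C] [Algebra k C] [FiniteDimensional k C]
    (E : Type) [AddCommGroup E] [Module C E] [Module Cᵐᵒᵖ E]
    (hgl : GlDimLE2 Cᵐᵒᵖ) (hE : IsRelExt k C E)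
    (N : Type) [AddCommGroup N] [Module Cᵐᵒᵖ N] [Module k N] [IsScalarTower k Cᵐᵒᵖ N]
    [FiniteDimensional k N]
    (hpd : HasProjectiveDimensionLT (ModuleCat.of Cᵐᵒᵖ N) 2)
    (f : E →ₗ[Cᵐᵒᵖ] N) : f = 0 := by
  classical
  obtain ⟨DC, φ, φadd, φadd', φk, φa, φnd, φnd', P2, P1, P0, d2, d1, d0, hP2, hP1, hP0,
    i2, s0, e1, e0, q, qs, q0, hact⟩ := hE
  -- every functional on `C` is represented
  have φ0 : ∀ m, φ 0 m = 0 := fun m => by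
    have := φadd 0 0 m
    simpa using this
  have φsmul : ∀ (c : k) n m, φ (op (algebraMap k C c) • n) m = c * φ n m := fun c n m => by
    rw [φa, φk]
  let W : Submodule k (Module.Dual k C) :=
    { carrier := {l | ∃ n, ∀ m, φ n m = l m}
      add_mem' := by
        rintro a b ⟨n, hn⟩ ⟨n', hn'⟩
        exact ⟨n + n', fun m => by rw [φadd, hn, hn']; rfl⟩
      zero_mem' := ⟨0, fun m => by rw [φ0]; rfl⟩
      smul_mem' := by
        rintro c a ⟨n, hn⟩
        exact ⟨op (algebraMap k C c) • n, fun m => by rw [φsmul, hn]; rfl⟩ }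
  let L : DC → Module.Dual k C := fun n =>
    { toFun := φ n
      map_add' := φadd' n
      map_smul' := fun c m => by
        rw [Algebra.smul_def, φk]; rfl }
  have hrep : ∀ l : Module.Dual k C, ∃ n, ∀ m, φ n m = l m := by
    have hW : W = ⊤ := by
      have h1 : W.dualCoannihilator = ⊥ := by
        rw [eq_bot_iff]
        intro m hm
        rw [Submodule.mem_dualCoannihilator] at hm
        exact φnd' m fun n => hm (L n) ⟨n, fun m => rfl⟩
      have h2 := Subspace.dualCoannihilator_dualAnnihilator_eq (W := W)
      rw [← h2, h1, Submodule.dualAnnihilator_bot]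
    intro l
    have : l ∈ W := hW ▸ Submodule.mem_top
    exact this
  have φext : ∀ n n', (∀ m, φ n m = φ n' m) → n = n' := fun n n' h => by
    rw [← sub_eq_zero]
    apply φnd
    intro m
    have h1 := φadd (n - n') n' m
    rw [sub_add_cancel, h m] at h1
    linear_combination -h1
  -- basis of `N`
  let b := Module.finBasis k N
  let ι := Fin (Module.finrank k N)
  have ksm : ∀ (c : k) (a : C) (n : N), op (c • a) • n = c • (op a • n) := fun c a n => by
    rw [MulOpposite.op_smul, smul_assoc]
  let ac : C →ₗ[k] N →ₗ[k] N := LinearMap.mk₂ k (fun c n => op c • n)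
    (fun c c' n => by rw [MulOpposite.op_add, add_smul]) (fun c a n => ksm c a n)
    (fun c n n' => smul_add _ _ _)
    (fun c a n => by
      have h1 : ∀ n : N, c • n = op (algebraMap k C c) • n := fun n => by
        rw [Algebra.algebraMap_eq_smul_one, ksm, MulOpposite.op_one, one_smul]
      rw [h1, h1, ← mul_smul, ← mul_smul, ← MulOpposite.op_mul, ← MulOpposite.op_mul, Algebra.commutes])
  have hac : ∀ c n, ac c n = op c • n := fun c n => rfl
  let Θ : (ι → C) →ₗ[k] Module.Dual k N :=
    ∑ j, ((LinearMap.llcomp k N N k (b.coord j)).comp ac).comp (LinearMap.proj j)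
  have hΘ : ∀ c n, Θ c n = ∑ j, b.coord j (op (c j) • n) := fun c n => by
    simp only [Θ, LinearMap.sum_apply]
    rfl
  let w := Module.finBasis k (LinearMap.ker Θ)
  let σ := Fin (Module.finrank k (LinearMap.ker Θ))
  have hw : ∀ (i : σ) n, ∑ j, b.coord j (op ((w i : ι → C) j) • n) = 0 := fun i n => by
    rw [← hΘ, LinearMap.mem_ker.1 (w i).2]; rfl
  have hact' : ∀ (i : σ) (j : ι), ∃ (μ : DC →ₗ[Cᵐᵒᵖ] DC) (f0 : P0 →ₗ[Cᵐᵒᵖ] P0)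
            (f1 : P1 →ₗ[Cᵐᵒᵖ] P1) (f2 : P2 →ₗ[Cᵐᵒᵖ] P2),
          (∀ n x, φ (μ n) x = φ n (x * (w i : ι → C) j)) ∧
          d0.comp f0 = μ.comp d0 ∧
          d1.comp f1 = f0.comp d1 ∧
          d2.comp f2 = f1.comp d2 ∧
          ∀ g : P2 →ₗ[Cᵐᵒᵖ] C, q (g.comp f2) = op ((w i : ι → C) j) • q g := fun i j => hact _
  choose μ f0 f1 f2 hμ h0 h1 h2 hq using hact'
  let α := matMap μ
  have φsum : ∀ (n : ι → DC) m, φ (∑ j, n j) m = ∑ j, φ (n j) m := fun n m => by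
    let a : DC →+ k := ⟨⟨fun n => φ n m, φ0 m⟩, fun x y => φadd x y m⟩
    exact map_sum a n _
  -- the embedding of `N`
  let Lf : ι → N → Module.Dual k C := fun j n =>
    (b.coord j).comp (ac.flip n)
  choose rep hrep' using hrep
  have hLf : ∀ j n m, φ (rep (Lf j n)) m = b.coord j (op m • n) := fun j n m => by
    rw [hrep']; rfl
  let Λ : N →ₗ[Cᵐᵒᵖ] (ι → DC) :=
    { toFun := fun n j => rep (Lf j n)
      map_add' := fun n n' => by
        ext j
        apply φext
        intro m
        rw [Pi.add_apply, φadd, hLf, hLf, hLf, smul_add, map_add]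
      map_smul' := fun a n => by
        ext j
        apply φext
        intro m
        obtain ⟨a, rfl⟩ := op_surjective a
        rw [RingHom.id_apply, Pi.smul_apply, φa, hLf, hLf, ← mul_smul, MulOpposite.op_mul] }
  have hΛ : ∀ n j m, φ (Λ n j) m = b.coord j (op m • n) := fun n j m => hLf j n m
  have Λinj : Function.Injective Λ := by
    intro n n' h
    apply b.ext_elem
    intro j
    have h1 := hΛ n j 1
    have h2 := hΛ n' j 1
    rw [h] at h1
    rw [h1, MulOpposite.op_one, one_smul, one_smul] at h2
    exact h2
  have Λr : LinearMap.range Λ = LinearMap.ker α := by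
    ext v
    constructor
    · rintro ⟨n, rfl⟩
      rw [LinearMap.mem_ker]
      ext i
      rw [matMap_apply]
      apply φext
      intro m
      rw [φsum, Pi.zero_apply, φ0, ← hw i (op m • n)]
      refine Finset.sum_congr rfl fun j _ => ?_
      rw [hμ, hΛ, MulOpposite.op_mul, mul_smul]
    · intro hv
      -- the functional on `ι → C`
      let Φ : Module.Dual k (ι → C) := ∑ j, (L (v j)).comp (LinearMap.proj j)
      have hΦ : ∀ c, Φ c = ∑ j, φ (v j) (c j) := fun c => by
        simp only [Φ, LinearMap.sum_apply]
        rfl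
      have hΦ0 : ∀ c ∈ LinearMap.ker Θ, Φ c = 0 := by
        intro c hc
        have hz : Φ.comp (LinearMap.ker Θ).subtype = 0 := by
          apply w.ext
          intro i
          have h3 := congrFun (LinearMap.mem_ker.1 hv) i
          have h4 : φ (α v i) 1 = 0 := by rw [h3, Pi.zero_apply, φ0]
          rw [matMap_apply, φsum] at h4
          change Φ (w i : ι → C) = 0
          rw [hΦ, ← h4]
          refine Finset.sum_congr rfl fun j _ => ?_
          rw [hμ, one_mul]
        exact LinearMap.congr_fun hz ⟨c, hc⟩
      have hmem : Φ ∈ LinearMap.range Θ.dualMap := by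
        rw [LinearMap.range_dualMap_eq_dualAnnihilator_ker]
        rw [Submodule.mem_dualAnnihilator]
        exact hΦ0
      obtain ⟨ξ, hξ⟩ := hmem
      obtain ⟨n, hn⟩ := (Module.bijective_dual_eval k N).2 ξ
      refine ⟨n, ?_⟩
      ext j
      apply φext
      intro m
      rw [hΛ]
      have h5 := LinearMap.congr_fun hξ (Pi.single j m)
      rw [LinearMap.dualMap_apply, ← hn, Module.Dual.eval_apply, hΘ, hΦ] at h5
      rw [Finset.sum_eq_single j, Finset.sum_eq_single j] at h5
      · simpa using h5
      · intro j' _ hj'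
        rw [Pi.single_eq_of_ne hj']
        exact (L (v j')).map_zero
      · simp
      · intro j' _ hj'
        rw [Pi.single_eq_of_ne hj', MulOpposite.op_zero, zero_smul, map_zero]
      · simp
  have hker : HasProjectiveDimensionLT (ModuleCat.of Cᵐᵒᵖ (LinearMap.ker α)) 2 :=
    pd_congr ((LinearEquiv.ofInjective Λ Λinj).trans (LinearEquiv.ofEq _ _ Λr)) 2 hpd
  have pj : ∀ (κ P : Type) [Finite κ] [AddCommGroup P] [Module Cᵐᵒᵖ P] [Module.Projective Cᵐᵒᵖ P],
    Module.Projective Cᵐᵒᵖ (κ → P) := fun κ P _ _ _ _ => projective_pi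
  have := pj ι P1
  have := pj ι P0
  have := pj σ P2
  have := pj σ P1
  have := pj σ P0
  obtain ⟨ρ, hρ⟩ := cone_split hgl (d2.compLeft ι) (d1.compLeft ι) (d0.compLeft ι)
    (fun x y h => funext fun j => i2 (congrFun h j))
    (fun y => ⟨fun j => (s0 (y j)).choose, funext fun j => (s0 (y j)).choose_spec⟩)
    (range_compLeft _ _ e1) (range_compLeft _ _ e0)
    (d2.compLeft σ) (d1.compLeft σ) (d0.compLeft σ)
    (fun x y h => funext fun j => i2 (congrFun h j))
    (fun y => ⟨fun j => (s0 (y j)).choose, funext fun j => (s0 (y j)).choose_spec⟩)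
    (range_compLeft _ _ e1) (range_compLeft _ _ e0)
    (matMap f2) (matMap f1) (matMap f0) α
    (matMap_comm _ _ _ h0) (matMap_comm _ _ _ h1) (matMap_comm _ _ _ h2) hker
  -- conclusion
  ext e
  obtain ⟨g, rfl⟩ := qs e
  apply b.ext_elem
  intro j
  let G0 : (ι → P2) →ₗ[Cᵐᵒᵖ] C := g.comp (LinearMap.proj j)
  let A : (ι → P1) →ₗ[Cᵐᵒᵖ] C := (G0.comp ρ).comp (LinearMap.inl _ _ _)
  let G : (σ → P2) →ₗ[Cᵐᵒᵖ] C := (G0.comp ρ).comp (LinearMap.inr _ _ _)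
  let G' : σ → (P2 →ₗ[Cᵐᵒᵖ] C) := fun i => G.comp (LinearMap.single Cᵐᵒᵖ (fun _ : σ => (P2 : Type)) i)
  have key : ∀ j', q (G0.comp (LinearMap.single Cᵐᵒᵖ (fun _ : ι => (P2 : Type)) j')) =
      ∑ i, op ((w i : ι → C) j') • q (G' i) := by
    intro j'
    have : G0.comp (LinearMap.single Cᵐᵒᵖ (fun _ : ι => (P2 : Type)) j') =
        (A.comp (LinearMap.single Cᵐᵒᵖ (fun _ : ι => (P1 : Type)) j')).comp d2 + ∑ i, (G' i).comp (f2 i j') := by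
      ext x
      have h3 : G0 (Pi.single j' x) = A (d2.compLeft ι (Pi.single j' x)) +
          G (matMap f2 (Pi.single j' x)) := by
        conv_lhs => rw [← hρ (Pi.single j' x)]
        simp only [A, G, LinearMap.comp_apply, LinearMap.inl_apply, LinearMap.inr_apply]
        rw [← map_add, ← map_add, Prod.mk_add_mk, add_zero, zero_add]
      have h4 : d2.compLeft ι (Pi.single j' x) = Pi.single j' (d2 x) := by
        ext l
        change d2 ((Pi.single j' x : ι → P2) l) = _
        by_cases hl : l = j'
        · subst hl; simp
        · simp [Pi.single_eq_of_ne hl]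
      have h5 : matMap f2 (Pi.single j' x) = ∑ i, Pi.single i (f2 i j' x) := by
        ext l
        rw [matMap_apply, Finset.sum_apply, Finset.sum_eq_single j', Finset.sum_eq_single l]
        · simp
        · intro i _ hi
          rw [Pi.single_eq_of_ne hi.symm]
        · simp
        · intro i _ hi
          rw [Pi.single_eq_of_ne hi, map_zero]
        · simp
      rw [h4, h5, map_sum] at h3
      simp only [LinearMap.comp_apply, LinearMap.add_apply, LinearMap.sum_apply, G',
        LinearMap.coe_single]
      exact h3
    rw [this, map_add, (q0 _).2 ⟨_, rfl⟩, zero_add, map_sum]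
    exact Finset.sum_congr rfl fun i _ => hq _ _ _
  have tot : ∑ j', b.coord j' (f (q (G0.comp (LinearMap.single Cᵐᵒᵖ (fun _ : ι => (P2 : Type)) j')))) = 0 := by
    simp only [key, map_sum, map_smul]
    rw [Finset.sum_comm]
    exact Finset.sum_eq_zero fun i _ => hw i _
  rw [Finset.sum_eq_single j] at tot
  · have : G0.comp (LinearMap.single Cᵐᵒᵖ (fun _ : ι => (P2 : Type)) j) = g := by
      ext x
      simp [G0]
    rw [this] at tot
    simpa using tot
  · intro j' _ hj'
    have : G0.comp (LinearMap.single Cᵐᵒᵖ (fun _ : ι => (P2 : Type)) j') = 0 := by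
      ext x
      simp [G0, Pi.single_eq_of_ne hj'.symm]
    rw [this, map_zero, map_zero, map_zero]
  · simp

end ExtVanish

section TauGeneric

theorem exists_dual_basis {A : Type} [Ring A] (P : Type) [AddCommGroup P] [Module Aᵐᵒᵖ P]
    [Module.Finite Aᵐᵒᵖ P] [Module.Projective Aᵐᵒᵖ P] :
    ∃ (n : ℕ) (p : Fin n → P) (c : Fin n → (P →ₗ[Aᵐᵒᵖ] A)), ∀ x, x = ∑ i, op (c i x) • p i := by
  classical
  obtain ⟨n, f, g, -, -, hfg⟩ := Module.Finite.exists_comp_eq_id_of_projective Aᵐᵒᵖ P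
  let u : Aᵐᵒᵖ →ₗ[Aᵐᵒᵖ] A :=
    { toFun := unop
      map_add' := fun _ _ => rfl
      map_smul' := fun _ _ => rfl }
  refine ⟨n, fun i => f (Pi.single i 1), fun i => (u.comp (LinearMap.proj i)).comp g, fun x => ?_⟩
  conv_lhs => rw [← LinearMap.id_apply (R := Aᵐᵒᵖ) x, ← hfg, LinearMap.comp_apply,
    pi_eq_sum_univ' (g x)]
  rw [map_sum]
  refine Finset.sum_congr rfl fun i _ => ?_
  rw [map_smul]
  rfl

/-- the map `p ↦ y · g(p)` -/
def rmul {A : Type} [Ring A] {P Y : Type} [AddCommGroup P] [Module Aᵐᵒᵖ P]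
    [AddCommGroup Y] [Module Aᵐᵒᵖ Y] (y : Y) (g : P →ₗ[Aᵐᵒᵖ] A) : P →ₗ[Aᵐᵒᵖ] Y where
  toFun p := op (g p) • y
  map_add' a b := by rw [map_add, MulOpposite.op_add, add_smul]
  map_smul' a p := by
    rw [map_smul, RingHom.id_apply, ← mul_smul]
    rfl

theorem rmul_apply {A : Type} [Ring A] {P Y : Type} [AddCommGroup P] [Module Aᵐᵒᵖ P]
    [AddCommGroup Y] [Module Aᵐᵒᵖ Y] (y : Y) (g : P →ₗ[Aᵐᵒᵖ] A) (p : P) :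
    rmul y g p = op (g p) • y := rfl

theorem dual_basis_fun {A : Type} [Ring A] {P : Type} [AddCommGroup P] [Module Aᵐᵒᵖ P]
    {n : ℕ} {p : Fin n → P} {c : Fin n → (P →ₗ[Aᵐᵒᵖ] A)} (h : ∀ x, x = ∑ i, op (c i x) • p i)
    (g : P →ₗ[Aᵐᵒᵖ] A) : g = ∑ i, g (p i) • c i := by
  ext x
  conv_lhs => rw [h x, map_sum]
  rw [LinearMap.sum_apply]
  refine Finset.sum_congr rfl fun i _ => ?_
  rw [map_smul]
  rfl

theorem hom_zero_of_factor {k : Type} [Field k] {A : Type} [Ring A] [Algebra k A]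
    {P1 P0 X T : Type} [AddCommGroup P1] [Module Aᵐᵒᵖ P1] [AddCommGroup P0] [Module Aᵐᵒᵖ P0]
    [AddCommGroup X] [Module Aᵐᵒᵖ X] [AddCommGroup T] [Module Aᵐᵒᵖ T]
    [Module.Finite Aᵐᵒᵖ P1] [Module.Projective Aᵐᵒᵖ P1]
    [Module.Finite Aᵐᵒᵖ P0] [Module.Projective Aᵐᵒᵖ P0]
    (d1 : P1 →ₗ[Aᵐᵒᵖ] P0) {Tr : Type} [AddCommGroup Tr] [Module A Tr]
    (q : (P1 →ₗ[Aᵐᵒᵖ] A) →ₗ[A] Tr) (qs : Function.Surjective q)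
    (q0 : ∀ f : P0 →ₗ[Aᵐᵒᵖ] A, q (f.comp d1) = 0)
    (ψ : T → Tr → k)
    (ψadd : ∀ n n' m, ψ (n + n') m = ψ n m + ψ n' m)
    (ψadd' : ∀ n m m', ψ n (m + m') = ψ n m + ψ n m')
    (ψa : ∀ (a : A) n m, ψ (op a • n) m = ψ n (a • m))
    (ψnd : ∀ n, (∀ m, ψ n m = 0) → n = 0)
    (hfac : ∀ u : P1 →ₗ[Aᵐᵒᵖ] X, ∃ h : P0 →ₗ[Aᵐᵒᵖ] X, u = h.comp d1)
    (f : X →ₗ[Aᵐᵒᵖ] T) : f = 0 := by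
  obtain ⟨n, p, c, hp⟩ := exists_dual_basis (A := A) P1
  obtain ⟨r, p', c', hp'⟩ := exists_dual_basis (A := A) P0
  let Ψ : T →+ Tr →+ k := AddMonoidHom.mk' (fun t => AddMonoidHom.mk' (ψ t) (ψadd' t))
    (fun a b => AddMonoidHom.ext fun m => ψadd a b m)
  have hΨ : ∀ t m, ψ t m = Ψ t m := fun _ _ => rfl
  have hΨa : ∀ (a : A) t m, Ψ (op a • t) m = Ψ t (a • m) := ψa
  ext x
  apply ψnd
  intro m
  obtain ⟨g, rfl⟩ := qs m
  obtain ⟨h, hh⟩ := hfac (rmul x g)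
  have S1 : ∑ i, Ψ (f (rmul x g (p i))) (q (c i)) = Ψ (f x) (q g) := by
    conv_rhs => rw [dual_basis_fun hp g, map_sum, map_sum]
    refine Finset.sum_congr rfl fun i _ => ?_
    rw [rmul_apply, map_smul, hΨa, ← q.map_smul]
  rw [hΨ, ← S1, hh]
  have S2 : ∀ i, Ψ (f (h.comp d1 (p i))) (q (c i)) =
      ∑ j, Ψ (f (h (p' j))) (q (c' j (d1 (p i)) • c i)) := fun i => by
    rw [LinearMap.comp_apply]
    conv_lhs => rw [hp' (d1 (p i)), map_sum, map_sum, map_sum, AddMonoidHom.finsetSum_apply]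
    refine Finset.sum_congr rfl fun j _ => ?_
    rw [map_smul, map_smul, hΨa, ← q.map_smul]
  simp only [S2]
  rw [Finset.sum_comm]
  refine Finset.sum_eq_zero fun j _ => ?_
  rw [← map_sum, ← map_sum]
  have := dual_basis_fun hp ((c' j).comp d1)
  simp only [LinearMap.comp_apply] at this
  rw [← this, q0, map_zero]

theorem factor_of_hom_zero {k : Type} [Field k] {A : Type} [Ring A] [Algebra k A]
    {P1 P0 Y T : Type} [AddCommGroup P1] [Module Aᵐᵒᵖ P1] [AddCommGroup P0] [Module Aᵐᵒᵖ P0]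
    [AddCommGroup Y] [Module Aᵐᵒᵖ Y] [AddCommGroup T] [Module Aᵐᵒᵖ T]
    [Module k Y] [IsScalarTower k Aᵐᵒᵖ Y] [SMulCommClass Aᵐᵒᵖ k Y]
    [Module.Finite Aᵐᵒᵖ P1] [Module.Projective Aᵐᵒᵖ P1]
    (d1 : P1 →ₗ[Aᵐᵒᵖ] P0) {Tr : Type} [AddCommGroup Tr] [Module A Tr]
    (q : (P1 →ₗ[Aᵐᵒᵖ] A) →ₗ[A] Tr) (qs : Function.Surjective q)
    (q0 : ∀ g, q g = 0 → ∃ f : P0 →ₗ[Aᵐᵒᵖ] A, g = f.comp d1)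
    (ψ : T → Tr → k)
    (ψadd : ∀ n n' m, ψ (n + n') m = ψ n m + ψ n' m)
    (ψa : ∀ (a : A) n m, ψ (op a • n) m = ψ n (a • m))
    (ψnd : ∀ n, (∀ m, ψ n m = 0) → n = 0)
    (ψrep : ∀ l : Tr → k, (∀ m m', l (m + m') = l m + l m') →
      (∀ (c : k) m, l (algebraMap k A c • m) = c * l m) → ∃ t, ∀ m, ψ t m = l m)
    (hz : ∀ f : Y →ₗ[Aᵐᵒᵖ] T, f = 0)
    (u : P1 →ₗ[Aᵐᵒᵖ] Y) : ∃ h : P0 →ₗ[Aᵐᵒᵖ] Y, u = h.comp d1 := by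
  obtain ⟨n, p, c, hp⟩ := exists_dual_basis (A := A) P1
  have ψext : ∀ n n', (∀ m, ψ n m = ψ n' m) → n = n' := fun n n' h => by
    rw [← sub_eq_zero]
    apply ψnd
    intro m
    have h1 := ψadd (n - n') n' m
    rw [sub_add_cancel, h m] at h1
    linear_combination -h1
  let S : Submodule k (P1 →ₗ[Aᵐᵒᵖ] Y) :=
    { carrier := {u | ∃ h : P0 →ₗ[Aᵐᵒᵖ] Y, u = h.comp d1}
      add_mem' := by
        rintro _ _ ⟨h, rfl⟩ ⟨h', rfl⟩
        exact ⟨h + h', by ext x; simp⟩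
      zero_mem' := ⟨0, by ext x; simp⟩
      smul_mem' := by
        rintro a _ ⟨h, rfl⟩
        exact ⟨a • h, by ext x; simp⟩ }
  by_contra hu
  have hu' : u ∉ S := hu
  obtain ⟨Λ, hΛu, hΛS⟩ := Submodule.exists_le_ker_of_notMem hu'
  have hadd : ∀ (y : Y) (g g' : P1 →ₗ[Aᵐᵒᵖ] A), rmul y (g + g') = rmul y g + rmul y g' :=
    fun y g g' => by
      ext x
      simp only [rmul_apply, LinearMap.add_apply, MulOpposite.op_add, add_smul]
  have hadd' : ∀ (y y' : Y) (g : P1 →ₗ[Aᵐᵒᵖ] A), rmul (y + y') g = rmul y g + rmul y' g :=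
    fun y y' g => by
      ext x
      simp only [rmul_apply, LinearMap.add_apply, smul_add]
  have hsm : ∀ (a : A) (y : Y) (g : P1 →ₗ[Aᵐᵒᵖ] A), rmul (op a • y) g = rmul y (a • g) :=
    fun a y g => by
      ext x
      simp only [rmul_apply, LinearMap.smul_apply, ← mul_smul, smul_eq_mul, MulOpposite.op_mul]
  have hk : ∀ (a : k) (y : Y), op (algebraMap k A a) • y = a • y := fun a y => by
    rw [Algebra.algebraMap_eq_smul_one, MulOpposite.op_smul, smul_assoc, MulOpposite.op_one,
      one_smul]
  have hk' : ∀ (a : k) (y : Y) (g : P1 →ₗ[Aᵐᵒᵖ] A),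
      rmul (a • y) g = a • rmul y g := fun a y g => by
    ext x
    simp only [rmul_apply, LinearMap.smul_apply]
    rw [smul_comm]
  have hwd : ∀ (y : Y) g g', q g = q g' → Λ (rmul y g) = Λ (rmul y g') := fun y g g' h => by
    obtain ⟨f, hf⟩ := q0 (g - g') (by rw [map_sub, h, sub_self])
    have h1 : g = f.comp d1 + g' := by rw [← hf, sub_add_cancel]
    have h2 : rmul y (f.comp d1) ∈ S := ⟨rmul y f, rfl⟩
    have h3 : Λ (rmul y (f.comp d1)) = 0 := hΛS h2
    rw [h1, hadd, map_add, h3, zero_add]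
  let l : Y → Tr → k := fun y m => Λ (rmul y (Function.surjInv qs m))
  have hl : ∀ y g, l y (q g) = Λ (rmul y g) := fun y g =>
    hwd y _ _ (Function.surjInv_eq qs (q g))
  have hex : ∀ y, ∃ t, ∀ m, ψ t m = l y m := fun y => by
    apply ψrep
    · intro m m'
      obtain ⟨g, rfl⟩ := qs m
      obtain ⟨g', rfl⟩ := qs m'
      rw [← map_add, hl, hl, hl, hadd, map_add]
    · intro a m
      obtain ⟨g, rfl⟩ := qs m
      rw [← map_smul, hl, hl, ← hsm, hk, hk', map_smul, smul_eq_mul]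
  choose t ht using hex
  have ht' : ∀ y g, ψ (t y) (q g) = Λ (rmul y g) := fun y g => by rw [ht, hl]
  let f : Y →ₗ[Aᵐᵒᵖ] T :=
    { toFun := t
      map_add' := fun y y' => by
        apply ψext
        intro m
        obtain ⟨g, rfl⟩ := qs m
        rw [ψadd, ht', ht', ht', hadd', map_add]
      map_smul' := fun a y => by
        obtain ⟨a, rfl⟩ := op_surjective a
        apply ψext
        intro m
        obtain ⟨g, rfl⟩ := qs m
        rw [RingHom.id_apply, ψa, ← map_smul, ht', ht', hsm] }
  have hf0 := hz f
  have ψ0 : ∀ m, ψ 0 m = 0 := fun m => by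
    have := ψadd 0 0 m
    simpa using this
  have hΛ0 : ∀ y g, Λ (rmul y g) = 0 := fun y g => by
    rw [← ht']
    have : t y = 0 := LinearMap.congr_fun hf0 y
    rw [this, ψ0]
  apply hΛu
  have : u = ∑ i, rmul (u (p i)) (c i) := by
    ext x
    conv_lhs => rw [hp x, map_sum]
    rw [LinearMap.sum_apply]
    refine Finset.sum_congr rfl fun i _ => ?_
    rw [map_smul]
    rfl
  rw [this, map_sum]
  exact Finset.sum_eq_zero fun i _ => hΛ0 _ _

theorem exists_kdual (k : Type) [Field k] (A : Type) [Ring A] [Algebra k A]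
    (Tr : Type) [AddCommGroup Tr] [Module A Tr] [Module k Tr] [IsScalarTower k A Tr]
    [FiniteDimensional k Tr] :
    ∃ (T : Mdl Aᵐᵒᵖ) (_ : Module k T) (_ : IsScalarTower k Aᵐᵒᵖ T) (_ : FiniteDimensional k T)
      (ψ : T → Tr → k),
      (∀ n n' m, ψ (n + n') m = ψ n m + ψ n' m) ∧
      (∀ n m m', ψ n (m + m') = ψ n m + ψ n m') ∧
      (∀ (c : k) n m, ψ n ((algebraMap k A c) • m) = c * ψ n m) ∧
      (∀ (a : A) n m, ψ (op a • n) m = ψ n (a • m)) ∧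
      (∀ n, (∀ m, ψ n m = 0) → n = 0) ∧
      (∀ m, (∀ n, ψ n m = 0) → m = 0) ∧
      (∀ l : Tr → k, (∀ m m', l (m + m') = l m + l m') →
        (∀ (c : k) m, l (algebraMap k A c • m) = c * l m) → ∃ t, ∀ m, ψ t m = l m) := by
  let sm : Aᵐᵒᵖ → Module.Dual k Tr → Module.Dual k Tr := fun a l =>
    { toFun := fun m => l (unop a • m)
      map_add' := fun m m' => by rw [smul_add, map_add]
      map_smul' := fun c m => by
        rw [RingHom.id_apply, ← map_smul, ← algebraMap_smul A c m, ← algebraMap_smul A c (_ • m),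
          ← mul_smul, ← mul_smul, Algebra.commutes] }
  letI : Module Aᵐᵒᵖ (Module.Dual k Tr) :=
    { smul := sm
      one_smul := fun l => LinearMap.ext fun m => by
        change l ((1 : A) • m) = _
        rw [one_smul]
      mul_smul := fun a b l => LinearMap.ext fun m => by
        change l ((unop b * unop a) • m) = l (unop b • unop a • m)
        rw [mul_smul]
      smul_zero := fun a => LinearMap.ext fun m => rfl
      zero_smul := fun l => LinearMap.ext fun m => by
        change l ((0 : A) • m) = _
        rw [zero_smul, map_zero]; rfl
      smul_add := fun a l l' => LinearMap.ext fun m => rfl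
      add_smul := fun a b l => LinearMap.ext fun m => by
        change l ((unop a + unop b) • m) = l (unop a • m) + l (unop b • m)
        rw [add_smul, map_add] }
  have hs : ∀ (a : Aᵐᵒᵖ) (l : Module.Dual k Tr) m, (a • l) m = l (unop a • m) := fun _ _ _ => rfl
  refine ⟨ModuleCat.of Aᵐᵒᵖ (Module.Dual k Tr),
    inferInstanceAs (Module k (Module.Dual k Tr)), ?_,
    inferInstanceAs (FiniteDimensional k (Module.Dual k Tr)),
    fun l m => (show Module.Dual k Tr from l) m, ?_, ?_, ?_, ?_, ?_, ?_, ?_⟩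
  · refine ⟨fun c a l => LinearMap.ext fun m => ?_⟩
    change (show Module.Dual k Tr from l) (unop (c • a) • m) =
      c • (show Module.Dual k Tr from l) (unop a • m)
    rw [MulOpposite.unop_smul, smul_assoc, map_smul]
  · intro n n' m; rfl
  · intro n m m'; exact map_add _ _ _
  · intro c n m
    change (show Module.Dual k Tr from n) _ = c * (show Module.Dual k Tr from n) m
    rw [algebraMap_smul, map_smul, smul_eq_mul]
  · intro a n m; rfl
  · intro n h; exact LinearMap.ext h
  · intro m h
    exact (Module.forall_dual_apply_eq_zero_iff k m).1 h
  · intro l h1 h2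
    refine ⟨({ toFun := l, map_add' := h1, map_smul' := fun c m => ?_ } : Module.Dual k Tr),
      fun m => rfl⟩
    rw [← algebraMap_smul A c m, h2]; rfl

theorem exists_projCover {R : Type} [Ring R] [IsArtinianRing R] (M : Mdl R) [Module.Finite R M] :
    ∃ (P : Mdl R) (f : P →ₗ[R] M), IsProjCover R f ∧ Module.Finite R P := by
  obtain ⟨n, π, hπ⟩ := Module.Finite.exists_fin' R M
  let S : Set (Submodule R (Fin n → R)) := {N | N ⊔ LinearMap.ker π = ⊤}
  obtain ⟨N, hN, hmin⟩ := (IsWellFounded.wf (r := ((· < ·) :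
    Submodule R (Fin n → R) → Submodule R (Fin n → R) → Prop))).has_min S ⟨⊤, top_sup_eq _⟩
  have hmin' : ∀ N' ≤ N, N' ⊔ LinearMap.ker π = ⊤ → N' = N := fun N' hle h =>
    hle.eq_of_not_lt (hmin N' h)
  have honto : ∀ N' : Submodule R (Fin n → R),
      (∀ m, ∃ x ∈ N', π x = m) → N' ⊔ LinearMap.ker π = ⊤ := fun N' h => by
    rw [eq_top_iff]
    intro x _
    obtain ⟨y, hy, hxy⟩ := h (π x)
    rw [Submodule.mem_sup]
    exact ⟨y, hy, x - y, by rw [LinearMap.mem_ker, map_sub, hxy, sub_self], by abel⟩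
  have honto' : ∀ N' : Submodule R (Fin n → R), N' ⊔ LinearMap.ker π = ⊤ →
      (∀ m, ∃ x ∈ N', π x = m) := fun N' h m => by
    obtain ⟨x, rfl⟩ := hπ m
    have : x ∈ N' ⊔ LinearMap.ker π := h ▸ Submodule.mem_top
    obtain ⟨y, hy, z, hz, rfl⟩ := Submodule.mem_sup.1 this
    exact ⟨y, hy, by rw [map_add, LinearMap.mem_ker.1 hz, add_zero]⟩
  let πN : N →ₗ[R] M := π.comp N.subtype
  have hπN : Function.Surjective πN := fun m => by
    obtain ⟨x, hx, h⟩ := honto' N hN m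
    exact ⟨⟨x, hx⟩, h⟩
  obtain ⟨h, hh⟩ := Module.projective_lifting_property πN π hπN
  have hh' : ∀ x, π (h x : Fin n → R) = π x := fun x => LinearMap.congr_fun hh x
  let e : N →ₗ[R] N := h.comp N.subtype
  have hes : Function.Surjective e := by
    have : (LinearMap.range e).map N.subtype = N := by
      apply hmin' _ (Submodule.map_subtype_le _ _)
      apply honto
      intro m
      obtain ⟨x, hx⟩ := hπN m
      exact ⟨e x, ⟨e x, ⟨x, rfl⟩, rfl⟩, by rw [← hx]; exact hh' x⟩
    intro y
    have hy : (y : Fin n → R) ∈ (LinearMap.range e).map N.subtype := this.ge y.2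
    obtain ⟨_, ⟨x, rfl⟩, hx⟩ := hy
    exact ⟨x, Subtype.ext hx⟩
  have hei : Function.Injective e := IsNoetherian.injective_of_surjective_endomorphism e hes
  let ee := LinearEquiv.ofBijective e ⟨hei, hes⟩
  have hP : Module.Projective R N := by
    refine Module.Projective.of_split N.subtype (ee.symm.toLinearMap.comp h) ?_
    ext x
    change ((ee.symm (e x) : N) : Fin n → R) _ = _
    have : ee.symm (e x) = x := ee.symm_apply_apply x
    rw [this]; rfl
  refine ⟨ModuleCat.of R N, πN, ⟨hP, hπN, fun N0 hN0 => ?_⟩, inferInstanceAs (Module.Finite R N)⟩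
  have h1 : N0.map N.subtype = N := by
    apply hmin' _ (Submodule.map_subtype_le _ _)
    apply honto
    intro m
    obtain ⟨x, rfl⟩ := hπN m
    have hx : x ∈ N0 ⊔ LinearMap.ker πN := hN0 ▸ Submodule.mem_top
    obtain ⟨y, hy, z, hz, rfl⟩ := Submodule.mem_sup.1 hx
    refine ⟨y, ⟨y, hy, rfl⟩, ?_⟩
    rw [map_add, LinearMap.mem_ker.1 hz, add_zero]; rfl
  rw [eq_top_iff]
  intro x _
  have hx : (x : Fin n → R) ∈ N0.map N.subtype := h1.ge x.2
  obtain ⟨y, hy, hxy⟩ := hx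
  have : y = x := Subtype.ext hxy
  exact this ▸ hy

theorem exists_minPres {R : Type} [Ring R] [IsArtinianRing R] (M : Mdl R) [Module.Finite R M] :
    ∃ (P1 P0 : Mdl R) (d1 : P1 →ₗ[R] P0) (d0 : P0 →ₗ[R] M), IsMinPres R d1 d0 ∧
      Module.Finite R P1 ∧ Module.Finite R P0 := by
  obtain ⟨P0, d0, h0, f0⟩ := exists_projCover M
  have : Module.Finite R (ModuleCat.of R (LinearMap.ker d0)) :=
    inferInstanceAs (Module.Finite R (LinearMap.ker d0))
  obtain ⟨P1, c, h1, f1⟩ := exists_projCover (ModuleCat.of R (LinearMap.ker d0))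
  let c' : P1 →ₗ[R] LinearMap.ker d0 := c
  have hk : LinearMap.ker ((LinearMap.ker d0).subtype.comp c') = LinearMap.ker c :=
    LinearMap.ker_comp_of_ker_eq_bot _ (Submodule.ker_subtype _)
  refine ⟨P1, P0, (LinearMap.ker d0).subtype.comp c', d0, ⟨h0, h1.1, ?_, ?_⟩, f1, f0⟩
  · have hc : LinearMap.range c' = ⊤ := LinearMap.range_eq_top.2 h1.2.1
    rw [LinearMap.range_comp, hc, Submodule.map_top, Submodule.range_subtype]
  · intro N hN
    rw [hk] at hN
    exact h1.2.2 N hN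

end TauGeneric

section InducedPres

/-- `φ` exhibits `X` as the induced module. -/
def IsInd {B C : Type} [Ring B] [Ring C] (σ : C →+* B) {M : Mdl Cᵐᵒᵖ} {X : Mdl Bᵐᵒᵖ}
    (φ : M →+ X) : Prop :=
  (∀ (c : C) (m : M), φ (op c • m) = op (σ c) • φ m) ∧
    ∀ (Y : Mdl Bᵐᵒᵖ) (ψ : M →+ Y),
      (∀ (c : C) (m : M), ψ (op c • m) = op (σ c) • ψ m) →
      ∃! h : X →ₗ[Bᵐᵒᵖ] Y, ∀ m, h (φ m) = ψ m

variable {B C : Type} [Ring B] [Ring C] {σ : C →+* B}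

theorem exists_induced (σ : C →+* B) (P : Mdl Cᵐᵒᵖ) :
    ∃ (X : Mdl Bᵐᵒᵖ) (φ : P →+ X), IsInd σ φ := by
  classical
  let s : Set (P →₀ Bᵐᵒᵖ) := {x | (∃ p p' : P, x = Finsupp.single (p + p') 1 -
      (Finsupp.single p 1 + Finsupp.single p' 1)) ∨
    ∃ (c : C) (p : P), x = Finsupp.single (op c • p) 1 - op (σ c) • Finsupp.single p 1}
  let K := Submodule.span Bᵐᵒᵖ s
  have h1 : ∀ p p' : P, K.mkQ (Finsupp.single (p + p') 1) =
      K.mkQ (Finsupp.single p 1) + K.mkQ (Finsupp.single p' 1) := fun p p' => by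
    rw [← map_add, ← sub_eq_zero, ← map_sub, Submodule.mkQ_apply, Submodule.Quotient.mk_eq_zero]
    exact Submodule.subset_span (Or.inl ⟨p, p', rfl⟩)
  refine ⟨ModuleCat.of _ ((P →₀ Bᵐᵒᵖ) ⧸ K),
    AddMonoidHom.mk' (fun p => K.mkQ (Finsupp.single p 1)) h1, fun c p => ?_, fun Y ψ hψ => ?_⟩
  · change K.mkQ (Finsupp.single (op c • p) 1) = op (σ c) • K.mkQ (Finsupp.single p 1)
    rw [← map_smul, ← sub_eq_zero, ← map_sub, Submodule.mkQ_apply, Submodule.Quotient.mk_eq_zero]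
    exact Submodule.subset_span (Or.inr ⟨c, p, rfl⟩)
  · let g : (P →₀ Bᵐᵒᵖ) →ₗ[Bᵐᵒᵖ] Y := Finsupp.linearCombination Bᵐᵒᵖ ψ
    have hg : ∀ p, g (Finsupp.single p 1) = ψ p := fun p => by
      simp [g, Finsupp.linearCombination_single]
    have hK : K ≤ LinearMap.ker g := by
      apply Submodule.span_le.2
      rintro _ (⟨p, p', rfl⟩ | ⟨c, p, rfl⟩)
      · change g _ = 0
        rw [map_sub, map_add, hg, hg, hg, map_add, sub_self]
      · change g _ = 0
        rw [map_sub, map_smul, hg, hg, hψ, sub_self]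
    refine ⟨K.liftQ g hK, fun m => hg m, fun h' hh' => ?_⟩
    apply Submodule.linearMap_qext
    ext p
    exact (hh' p).trans (hg p).symm

theorem IsInd.ext {M : Mdl Cᵐᵒᵖ} {X : Mdl Bᵐᵒᵖ} {φ : M →+ X} (hφ : IsInd σ φ) {Y : Mdl Bᵐᵒᵖ}
    {h h' : X →ₗ[Bᵐᵒᵖ] Y} (hh : ∀ m, h (φ m) = h' (φ m)) : h = h' := by
  obtain ⟨g, -, hg⟩ := hφ.2 Y (h.toAddMonoidHom.comp φ) (fun c m => by
    change h (φ _) = op (σ c) • h (φ m)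
    rw [hφ.1, map_smul])
  rw [hg h (fun m => rfl), hg h' (fun m => (hh m).symm)]

theorem IsInd.span {M : Mdl Cᵐᵒᵖ} {X : Mdl Bᵐᵒᵖ} {φ : M →+ X} (hφ : IsInd σ φ) :
    Submodule.span Bᵐᵒᵖ (Set.range φ) = ⊤ := by
  let K := Submodule.span Bᵐᵒᵖ (Set.range φ)
  have h : K.mkQ = 0 := hφ.ext (Y := ModuleCat.of Bᵐᵒᵖ (X ⧸ K)) (fun m => by
    change K.mkQ (φ m) = 0
    rw [Submodule.mkQ_apply, Submodule.Quotient.mk_eq_zero]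
    exact Submodule.subset_span ⟨m, rfl⟩)
  have := Submodule.ker_mkQ K
  rw [h, LinearMap.ker_zero] at this
  exact this.symm

theorem IsInd.finite {M : Mdl Cᵐᵒᵖ} {X : Mdl Bᵐᵒᵖ} {φ : M →+ X} (hφ : IsInd σ φ)
    [hM : Module.Finite Cᵐᵒᵖ M] : Module.Finite Bᵐᵒᵖ X := by
  classical
  obtain ⟨s, hs⟩ := hM.fg_top
  refine ⟨⟨s.image φ, ?_⟩⟩
  rw [eq_top_iff, ← hφ.span, Submodule.span_le]
  rintro _ ⟨m, rfl⟩
  have hm : m ∈ Submodule.span Cᵐᵒᵖ (s : Set M) := hs ▸ Submodule.mem_top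
  induction hm using Submodule.span_induction with
  | mem x hx => exact Submodule.subset_span (by simpa using ⟨x, hx, rfl⟩)
  | zero => rw [map_zero]; exact Submodule.zero_mem _
  | add x y _ _ hx hy => rw [map_add]; exact Submodule.add_mem _ hx hy
  | smul c x _ hx =>
    obtain ⟨c, rfl⟩ := op_surjective c
    rw [hφ.1]
    exact Submodule.smul_mem _ _ hx

/-- universal property, `C`-linear version -/
theorem IsInd.lift {M : Mdl Cᵐᵒᵖ} {X : Mdl Bᵐᵒᵖ} {φ : M →+ X} (hφ : IsInd σ φ) {Y : Mdl Bᵐᵒᵖ}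
    (g : M →ₗ[Cᵐᵒᵖ] modAlong σ Y) : ∃ h : X →ₗ[Bᵐᵒᵖ] Y, ∀ m, h (φ m) = (g m : modAlong σ Y) := by
  obtain ⟨h, hh, -⟩ := hφ.2 Y (g.toAddMonoidHom : M →+ modAlong σ Y) (fun c m => g.map_smul (op c) m)
  exact ⟨h, hh⟩

/-- restriction of scalars of a map -/
def resMap (σ : C →+* B) {X Y : Mdl Bᵐᵒᵖ} (f : X →ₗ[Bᵐᵒᵖ] Y) :
    modAlong σ X →ₗ[Cᵐᵒᵖ] modAlong σ Y where
  toFun x := (f (x : X) : Y)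
  map_add' x y := f.map_add x y
  map_smul' c x := f.map_smul (RingHom.op σ c) x

/-- the unit, as a `C`-linear map -/
def unitMap {M : Mdl Cᵐᵒᵖ} {X : Mdl Bᵐᵒᵖ} {φ : M →+ X} (hφ : IsInd σ φ) :
    M →ₗ[Cᵐᵒᵖ] modAlong σ X where
  toFun x := (φ x : X)
  map_add' x y := φ.map_add x y
  map_smul' c x := hφ.1 (unop c) x

theorem IsInd.projective {M : Mdl Cᵐᵒᵖ} {X : Mdl Bᵐᵒᵖ} {φ : M →+ X} (hφ : IsInd σ φ)
    [hM : Module.Projective Cᵐᵒᵖ M] : Module.Projective Bᵐᵒᵖ X := by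
  refine Module.Projective.of_lifting_property'' fun f hf => ?_
  obtain ⟨g, hg⟩ := Module.projective_lifting_property
    (resMap σ (X := ModuleCat.of Bᵐᵒᵖ (X →₀ Bᵐᵒᵖ)) (Y := X) f) (unitMap hφ) hf
  obtain ⟨h, hh⟩ := hφ.lift (Y := ModuleCat.of Bᵐᵒᵖ (X →₀ Bᵐᵒᵖ)) g
  refine ⟨h, hφ.ext fun m => ?_⟩
  change f (h (φ m)) = φ m
  rw [hh]
  exact LinearMap.congr_fun hg m

theorem IsInd.exact {P1 P0 M : Mdl Cᵐᵒᵖ} {Q1 Q0 X : Mdl Bᵐᵒᵖ} {φ1 : P1 →+ Q1} {φ0 : P0 →+ Q0}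
    {φ : M →+ X} (h1 : IsInd σ φ1) (h0 : IsInd σ φ0) (h : IsInd σ φ)
    {d1 : P1 →ₗ[Cᵐᵒᵖ] P0} {d0 : P0 →ₗ[Cᵐᵒᵖ] M} (hd0 : Function.Surjective d0)
    (hd : LinearMap.range d1 = LinearMap.ker d0) :
    ∃ (D1 : Q1 →ₗ[Bᵐᵒᵖ] Q0) (D0 : Q0 →ₗ[Bᵐᵒᵖ] X), (∀ x, D1 (φ1 x) = φ0 (d1 x)) ∧
      (∀ x, D0 (φ0 x) = φ (d0 x)) ∧ Function.Surjective D0 ∧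
      LinearMap.range D1 = LinearMap.ker D0 := by
  obtain ⟨D1, hD1⟩ := h1.lift ((unitMap h0).comp d1)
  obtain ⟨D0, hD0⟩ := h0.lift ((unitMap h).comp d0)
  have hD1' : ∀ x, D1 (φ1 x) = φ0 (d1 x) := hD1
  have hD0' : ∀ x, D0 (φ0 x) = φ (d0 x) := hD0
  refine ⟨D1, D0, hD1', hD0', ?_, ?_⟩
  · rw [← LinearMap.range_eq_top, eq_top_iff, ← h.span, Submodule.span_le]
    rintro _ ⟨m, rfl⟩
    obtain ⟨p, rfl⟩ := hd0 m
    exact ⟨φ0 p, hD0' p⟩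
  · apply le_antisymm
    · rw [LinearMap.range_le_ker_iff]
      apply h1.ext
      intro x
      have hx : d0 (d1 x) = 0 := LinearMap.mem_ker.1 (hd ▸ LinearMap.mem_range_self d1 x)
      rw [LinearMap.comp_apply, hD1', hD0', hx, map_zero]; rfl
    · let K := LinearMap.range D1
      let Q : Mdl Bᵐᵒᵖ := ModuleCat.of Bᵐᵒᵖ (Q0 ⧸ K)
      let π : Q0 →ₗ[Bᵐᵒᵖ] Q := K.mkQ
      have hπ1 : ∀ x, π (D1 x) = 0 := fun x => (Submodule.Quotient.mk_eq_zero K).2 ⟨x, rfl⟩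
      have hwd : ∀ p p', d0 p = d0 p' → π (φ0 p) = π (φ0 p') := fun p p' hp => by
        have hm : p - p' ∈ LinearMap.range d1 := by
          rw [hd, LinearMap.mem_ker, map_sub, hp, sub_self]
        obtain ⟨x, hx⟩ := hm
        rw [← sub_eq_zero, ← map_sub, ← map_sub, ← hx, ← hD1', hπ1]
      let ψf : M → Q := fun m => π (φ0 (Function.surjInv hd0 m))
      have hψf : ∀ p, ψf (d0 p) = π (φ0 p) := fun p => hwd _ _ (Function.surjInv_eq hd0 _)
      let ψ : M →+ Q := AddMonoidHom.mk' ψf (fun a b => by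
        obtain ⟨a, rfl⟩ := hd0 a
        obtain ⟨b, rfl⟩ := hd0 b
        rw [← map_add, hψf, hψf, hψf, map_add, map_add])
      obtain ⟨g, hg, -⟩ := h.2 Q ψ (fun c m => by
        obtain ⟨a, rfl⟩ := hd0 m
        change ψf _ = _ • ψf _
        rw [← map_smul, hψf, hψf, h0.1, map_smul])
      have hgD : g.comp D0 = π := h0.ext fun p => by
        rw [LinearMap.comp_apply, hD0', hg]
        exact hψf p
      intro x hx
      have : π x = 0 := by
        rw [← hgD, LinearMap.comp_apply, LinearMap.mem_ker.1 hx, map_zero]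
      exact (Submodule.Quotient.mk_eq_zero K).1 this

end InducedPres

section Comparison

variable {R : Type} [Ring R]

theorem bij_of_superfluous {P M : Type} [AddCommGroup P] [Module R P] [AddCommGroup M] [Module R M]
    [Module.Projective R P] (f : P →ₗ[R] M)
    (hs : ∀ N : Submodule R P, N ⊔ LinearMap.ker f = ⊤ → N = ⊤) (e : P →ₗ[R] P)
    (h1 : LinearMap.range e ⊔ LinearMap.ker f = ⊤) (h2 : LinearMap.ker e ≤ LinearMap.ker f) :
    Function.Bijective e := by
  have hsurj : Function.Surjective e := LinearMap.range_eq_top.1 (hs _ h1)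
  refine ⟨?_, hsurj⟩
  obtain ⟨s, hs'⟩ := Module.projective_lifting_property e LinearMap.id hsurj
  have hes : ∀ x, e (s x) = x := fun x => LinearMap.congr_fun hs' x
  have htop : LinearMap.range s = ⊤ := by
    apply hs
    rw [eq_top_iff]
    intro x _
    rw [Submodule.mem_sup]
    refine ⟨s (e x), ⟨_, rfl⟩, x - s (e x), h2 ?_, by abel⟩
    rw [LinearMap.mem_ker, map_sub, hes, sub_self]
  intro x y hxy
  obtain ⟨x, rfl⟩ := LinearMap.range_eq_top.1 htop x
  obtain ⟨y, rfl⟩ := LinearMap.range_eq_top.1 htop y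
  rw [hes, hes] at hxy
  rw [hxy]

theorem lift_pres {P1 P0 Q1 Q0 X : Type} [AddCommGroup P1] [Module R P1] [AddCommGroup P0]
    [Module R P0] [AddCommGroup Q1] [Module R Q1] [AddCommGroup Q0] [Module R Q0]
    [AddCommGroup X] [Module R X] [Module.Projective R P1] [Module.Projective R P0]
    (d1 : P1 →ₗ[R] P0) (d0 : P0 →ₗ[R] X) (D1 : Q1 →ₗ[R] Q0) (D0 : Q0 →ₗ[R] X)
    (hc : ∀ x, d0 (d1 x) = 0)
    (hD0 : Function.Surjective D0) (hD : LinearMap.range D1 = LinearMap.ker D0) :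
    ∃ (a1 : P1 →ₗ[R] Q1) (a0 : P0 →ₗ[R] Q0), (∀ x, D0 (a0 x) = d0 x) ∧
      ∀ x, D1 (a1 x) = a0 (d1 x) := by
  obtain ⟨a0, ha0⟩ := Module.projective_lifting_property D0 d0 hD0
  have ha0' : ∀ x, D0 (a0 x) = d0 x := fun x => LinearMap.congr_fun ha0 x
  let t : P1 →ₗ[R] LinearMap.range D1 := (a0.comp d1).codRestrict _ (fun x => by
    rw [hD, LinearMap.mem_ker, LinearMap.comp_apply, ha0', hc])
  obtain ⟨a1, ha1⟩ := Module.projective_lifting_property D1.rangeRestrict t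
    D1.surjective_rangeRestrict
  exact ⟨a1, a0, ha0', fun x => congrArg Subtype.val (LinearMap.congr_fun ha1 x)⟩

theorem compare_pres {P1 P0 X : Mdl R} {Q1 Q0 : Type} [AddCommGroup Q1] [Module R Q1]
    [AddCommGroup Q0] [Module R Q0] [Module.Projective R Q1] [Module.Projective R Q0]
    [Module.Finite R Q1] [Module.Finite R Q0]
    {d1 : P1 →ₗ[R] P0} {d0 : P0 →ₗ[R] X} (hmin : IsMinPres R d1 d0)
    (D1 : Q1 →ₗ[R] Q0) (D0 : Q0 →ₗ[R] X)
    (hD0 : Function.Surjective D0) (hD : LinearMap.range D1 = LinearMap.ker D0)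
    (hfac : ∀ u : Q1 →ₗ[R] X, ∃ h : Q0 →ₗ[R] X, u = h.comp D1) :
    Module.Finite R P1 ∧ Module.Finite R P0 ∧
    ∀ u : P1 →ₗ[R] X, ∃ h : P0 →ₗ[R] X, u = h.comp d1 := by
  obtain ⟨⟨hP0, hd0, hs0⟩, hP1, hd, hs1⟩ := hmin
  have hdc : ∀ x, d0 (d1 x) = 0 := fun x => LinearMap.mem_ker.1 (hd ▸ LinearMap.mem_range_self d1 x)
  have hDc : ∀ x, D0 (D1 x) = 0 := fun x => LinearMap.mem_ker.1 (hD ▸ LinearMap.mem_range_self D1 x)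
  obtain ⟨a1, a0, ha0, ha1⟩ := lift_pres d1 d0 D1 D0 hdc hD0 hD
  obtain ⟨b1, b0, hb0, hb1⟩ := lift_pres D1 D0 d1 d0 hDc hd0 hd
  have he0 : Function.Bijective (b0.comp a0) := by
    apply bij_of_superfluous d0 hs0
    · rw [eq_top_iff]
      intro x _
      rw [Submodule.mem_sup]
      refine ⟨b0 (a0 x), ⟨x, rfl⟩, x - b0 (a0 x), ?_, by abel⟩
      rw [LinearMap.mem_ker, map_sub, hb0, ha0, sub_self]
    · intro x hx
      rw [LinearMap.mem_ker] at hx ⊢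
      have hx' : b0 (a0 x) = 0 := hx
      rw [← ha0, ← hb0, hx', map_zero]
  have hcomm : ∀ x, d1 (b1 (a1 x)) = b0 (a0 (d1 x)) := fun x => by rw [hb1, ha1]
  have he1 : Function.Bijective (b1.comp a1) := by
    apply bij_of_superfluous d1 hs1
    · rw [eq_top_iff]
      intro x _
      obtain ⟨y, hy⟩ := he0.2 (d1 x)
      have hy' : b0 (a0 y) = d1 x := hy
      have hyk : y ∈ LinearMap.range d1 := by
        rw [hd, LinearMap.mem_ker, ← ha0, ← hb0, hy', hdc]
      obtain ⟨z, rfl⟩ := hyk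
      rw [Submodule.mem_sup]
      refine ⟨b1 (a1 z), ⟨z, rfl⟩, x - b1 (a1 z), ?_, by abel⟩
      rw [LinearMap.mem_ker, map_sub, hcomm, hy', sub_self]
    · intro x hx
      rw [LinearMap.mem_ker] at hx ⊢
      apply he0.1
      rw [map_zero, LinearMap.comp_apply, ← hcomm]
      have : b1 (a1 x) = 0 := hx
      rw [this, map_zero]
  refine ⟨Module.Finite.of_surjective b1 fun x => ?_, Module.Finite.of_surjective b0 fun x => ?_,
    fun u => ?_⟩
  · obtain ⟨y, hy⟩ := he1.2 x
    exact ⟨a1 y, hy⟩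
  · obtain ⟨y, hy⟩ := he0.2 x
    exact ⟨a0 y, hy⟩
  · let e := LinearEquiv.ofBijective _ he1
    obtain ⟨h, hh⟩ := hfac ((u.comp e.symm.toLinearMap).comp b1)
    refine ⟨h.comp a0, LinearMap.ext fun x => ?_⟩
    have h1 := LinearMap.congr_fun hh (a1 x)
    have h2 : e.symm (b1 (a1 x)) = x := e.symm_apply_apply x
    simp only [LinearMap.comp_apply, LinearEquiv.coe_coe, h2] at h1
    rw [h1, LinearMap.comp_apply, LinearMap.comp_apply, ha1]

end Comparison

section FinalSteps

theorem exists_tau (k : Type) [Field k] (C : Type) [Ring C] [Algebra k C] [FiniteDimensional k C]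
    {P1 P0 : Mdl Cᵐᵒᵖ} (d1 : P1 →ₗ[Cᵐᵒᵖ] P0)
    [Module.Finite Cᵐᵒᵖ P1] [Module.Projective Cᵐᵒᵖ P1] :
    ∃ (Tr : Mdl C) (q : (P1 →ₗ[Cᵐᵒᵖ] C) →ₗ[C] Tr) (T : Mdl Cᵐᵒᵖ) (_ : Module k T)
      (_ : IsScalarTower k Cᵐᵒᵖ T) (_ : FiniteDimensional k T) (ψ : T → Tr → k),
      Function.Surjective q ∧
      (∀ g : P1 →ₗ[Cᵐᵒᵖ] C, q g = 0 ↔ ∃ f : P0 →ₗ[Cᵐᵒᵖ] C, g = f.comp d1) ∧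
      (∀ n n' m, ψ (n + n') m = ψ n m + ψ n' m) ∧
      (∀ n m m', ψ n (m + m') = ψ n m + ψ n m') ∧
      (∀ (c : k) n m, ψ n ((algebraMap k C c) • m) = c * ψ n m) ∧
      (∀ (a : C) n m, ψ (op a • n) m = ψ n (a • m)) ∧
      (∀ n, (∀ m, ψ n m = 0) → n = 0) ∧
      (∀ m, (∀ n, ψ n m = 0) → m = 0) ∧
      (∀ l : Tr → k, (∀ m m', l (m + m') = l m + l m') →
        (∀ (c : k) m, l (algebraMap k C c • m) = c * l m) → ∃ t, ∀ m, ψ t m = l m) := by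
  let K : Submodule C (P1 →ₗ[Cᵐᵒᵖ] C) :=
    { carrier := {u | ∃ h : P0 →ₗ[Cᵐᵒᵖ] C, u = h.comp d1}
      add_mem' := by
        rintro _ _ ⟨h, rfl⟩ ⟨h', rfl⟩
        exact ⟨h + h', by ext x; simp⟩
      zero_mem' := ⟨0, by ext x; simp⟩
      smul_mem' := by
        rintro a _ ⟨h, rfl⟩
        exact ⟨a • h, by ext x; simp⟩ }
  obtain ⟨n, p, c, hp⟩ := exists_dual_basis (A := C) P1
  have hfin : Module.Finite C (P1 →ₗ[Cᵐᵒᵖ] C) := by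
    classical
    refine ⟨⟨Finset.univ.image c, ?_⟩⟩
    rw [eq_top_iff]
    intro g _
    rw [dual_basis_fun hp g]
    refine Submodule.sum_mem _ fun i _ => Submodule.smul_mem _ _ (Submodule.subset_span ?_)
    simp
  have hfin' : FiniteDimensional k ((P1 →ₗ[Cᵐᵒᵖ] C) ⧸ K) := Module.Finite.trans C _
  obtain ⟨T, i1, i2, i3, ψ, h⟩ := exists_kdual k C ((P1 →ₗ[Cᵐᵒᵖ] C) ⧸ K)
  exact ⟨ModuleCat.of C ((P1 →ₗ[Cᵐᵒᵖ] C) ⧸ K), K.mkQ, T, i1, i2, i3, ψ, K.mkQ_surjective,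
    fun g => Submodule.Quotient.mk_eq_zero K, h⟩

theorem hom_ind_zero {C : Type} [Ring C]
    {E : Type} [AddCommGroup E] [Module C E] [Module Cᵐᵒᵖ E] [SMulCommClass C Cᵐᵒᵖ E]
    {M : Mdl Cᵐᵒᵖ} {X : Mdl (TrivSqZeroExt C E)ᵐᵒᵖ} {φ : M →+ X} (hφ : IsInd (tszeInl C E) φ)
    (T : Mdl Cᵐᵒᵖ) (h1 : HomZero Cᵐᵒᵖ M T) (h2 : ∀ f : E →ₗ[Cᵐᵒᵖ] T, f = 0)
    (f : modAlong (tszeInl C E) X →ₗ[Cᵐᵒᵖ] T) : f = 0 := by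
  let F : X →+ T := f.toAddMonoidHom
  have hF : ∀ (c : C) (x : X), F (op (TrivSqZeroExt.inl c : TrivSqZeroExt C E) • x) = op c • F x :=
    fun c x => f.map_smul (op c) x
  have hM : ∀ m, F (φ m) = 0 := fun m => LinearMap.congr_fun (h1 (f.comp (unitMap hφ))) m
  have hE : ∀ m (e : E), F (op (TrivSqZeroExt.inr e : TrivSqZeroExt C E) • φ m) = 0 := fun m e => by
    let g : E →ₗ[Cᵐᵒᵖ] T :=
      { toFun := fun e => F (op (TrivSqZeroExt.inr e : TrivSqZeroExt C E) • φ m)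
        map_add' := fun e e' => by
          rw [TrivSqZeroExt.inr_add, MulOpposite.op_add, add_smul, map_add]
        map_smul' := fun c e => by
          obtain ⟨c, rfl⟩ := op_surjective c
          rw [RingHom.id_apply, ← hF, ← mul_smul, ← MulOpposite.op_mul, TrivSqZeroExt.inr_mul_inl] }
    exact LinearMap.congr_fun (h2 g) e
  have key : ∀ x : X, ∀ b : (TrivSqZeroExt C E)ᵐᵒᵖ, F (b • x) = 0 := fun x => by
    have hx : x ∈ Submodule.span (TrivSqZeroExt C E)ᵐᵒᵖ (Set.range φ) := hφ.span ▸ Submodule.mem_top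
    induction hx using Submodule.span_induction with
    | mem x hx =>
      obtain ⟨m, rfl⟩ := hx
      intro b
      obtain ⟨b, rfl⟩ := op_surjective b
      rw [← TrivSqZeroExt.inl_fst_add_inr_snd_eq b, MulOpposite.op_add, add_smul, map_add, hE, hF,
        hM, smul_zero, add_zero]
    | zero => intro b; rw [smul_zero, map_zero]
    | add x y _ _ hx hy => intro b; rw [smul_add, map_add, hx, hy, add_zero]
    | smul c x _ hx => intro b; rw [← mul_smul, hx]
  have key' : ∀ x : X, F x = 0 := fun x => by
    have := key x 1
    rwa [one_smul] at this
  exact LinearMap.ext fun x => key' x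

end FinalSteps


/-- If `M` is `τ_C`-rigid with `pd_C (τ_C M) ≤ 1`, then the induced module
`M ⊗_C B` is `τ_B`-rigid. -/
theorem induced_tauB_rigid
    (k : Type) [Field k] (C : Type) [Ring C] [Algebra k C] [FiniteDimensional k C]
    (E : Type) [AddCommGroup E] [Module C E] [Module Cᵐᵒᵖ E] [SMulCommClass C Cᵐᵒᵖ E]
    [Module k E] [IsScalarTower k C E] [IsScalarTower k Cᵐᵒᵖ E]
    (hgl : GlDimEq2 Cᵐᵒᵖ) (hE : IsRelExt k C E)
    (M : Mdl Cᵐᵒᵖ) [Module.Finite Cᵐᵒᵖ M]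
    (hrigid : TauRigid k C M)
    (hpd : ∀ T, IsTau k C M T → PdLE1 Cᵐᵒᵖ T) :
    ∀ X, IsInduced C E M X → TauRigid k (TrivSqZeroExt C E) X := by
  intro X hX T' hT'
  obtain ⟨φ, hφ0⟩ := hX
  have hφ : IsInd (tszeInl C E) φ := hφ0
  have hart : IsArtinianRing Cᵐᵒᵖ := IsArtinianRing.of_finite k Cᵐᵒᵖ
  obtain ⟨P1, P0, d1, d0, hmin, f1, f0⟩ := exists_minPres M
  have hP1 : Module.Projective Cᵐᵒᵖ P1 := hmin.2.1
  have hP0 : Module.Projective Cᵐᵒᵖ P0 := hmin.1.1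
  obtain ⟨Tr, q, T, i1, i2, i3, ψ, hqs, hq, ψ1, ψ2, ψ3, ψ4, ψ5, ψ6, ψ7⟩ := exists_tau k C d1
  have hT : IsTau k C M T :=
    ⟨P1, P0, d1, d0, hmin, Tr, q, hqs, hq, ψ, ψ1, ψ2, ψ3, ψ4, ψ5, ψ6⟩
  have hz : ∀ f : modAlong (tszeInl C E) X →ₗ[Cᵐᵒᵖ] T, f = 0 :=
    hom_ind_zero hφ T (hrigid T hT) fun f =>
      hom_relExt_zero k C E hgl.1 hE T (hpd T hT).lt f
  let Y : Mdl Cᵐᵒᵖ := modAlong (tszeInl C E) X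
  let iY : Module k Y := Module.compHom Y (algebraMap k Cᵐᵒᵖ)
  have iY1 : IsScalarTower k Cᵐᵒᵖ Y := IsScalarTower.of_algebraMap_smul fun _ _ => rfl
  have iY2 : SMulCommClass Cᵐᵒᵖ k Y := ⟨fun a c y => by
    rw [← algebraMap_smul Cᵐᵒᵖ c y, ← algebraMap_smul Cᵐᵒᵖ c (a • y), ← mul_smul, ← mul_smul,
      Algebra.commutes]⟩
  have hfac : ∀ u : P1 →ₗ[Cᵐᵒᵖ] Y, ∃ h : P0 →ₗ[Cᵐᵒᵖ] Y, u = h.comp d1 := fun u =>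
    factor_of_hom_zero (k := k) d1 q hqs (fun g => (hq g).1) ψ ψ1 ψ4 ψ5 ψ7 hz u
  obtain ⟨Q1, φ1, hφ1⟩ := exists_induced (tszeInl C E) P1
  obtain ⟨Q0, φ0, hφ0'⟩ := exists_induced (tszeInl C E) P0
  obtain ⟨D1, D0, hD1, hD0, hD0s, hD⟩ := IsInd.exact hφ1 hφ0' hφ hmin.1.2.1 hmin.2.2.1
  have := hφ1.projective
  have := hφ0'.projective
  have := hφ1.finite
  have := hφ0'.finite
  obtain ⟨R1, R0, e1, e0, hmin', Tr', q', hqs', hq', ψ', k1, k2, k3, k4, k5, k6⟩ := hT'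
  obtain ⟨g1, g0, hf⟩ := compare_pres hmin' D1 D0 hD0s hD (fun u => by
    obtain ⟨h, hh⟩ := hfac ((resMap (tszeInl C E) u).comp (unitMap hφ1))
    obtain ⟨H, hH⟩ := hφ0'.lift h
    refine ⟨H, hφ1.ext fun p => ?_⟩
    rw [LinearMap.comp_apply, hD1, hH]
    exact LinearMap.congr_fun hh p)
  have := hmin'.2.1
  have := hmin'.1.1
  intro f
  exact hom_zero_of_factor (k := k) e1 q' hqs' (fun f => (hq' _).2 ⟨f, rfl⟩) ψ' k1 k2 k4 k5 hf f
end
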